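/- arXiv:1707.07288 — 9 statements merged into one kernel-verified Lean document; each statement's English description precedes it below -/
import Mathlib

section
/- Let r ≥ 2 and ν > 2r be integers with ν odd. Then the Harary graph H_{2r,ν} is (2r−1)-factor-critical. -/
open SimpleGraph

/-- `G` is `n`-factor-critical if for every set `S` of exactly `n` vertices,
the graph obtained by deleting `S` has a perfect matching; formalized as:
there is a matching of `G` whose vertex set is exactly the complement of `S`. -/
def IsFactorCritical {V : Type*} (G : SimpleGraph V) (n : ℕ) : Prop :=
  ∀ S : Finset V, S.card = n →
    ∃ M : G.Subgraph, M.IsMatching ∧ M.verts = (↑S : Set V)ᶜ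

/-- `G` is `k`-extendable if it is connected, has a matching with `k` edges,
and every matching with `k` edges is contained in a perfect matching. -/
def IsExtendable {V : Type*} (G : SimpleGraph V) (k : ℕ) : Prop :=
  G.Connected ∧
  (∃ M : G.Subgraph, M.IsMatching ∧ M.edgeSet.ncard = k) ∧
  ∀ M : G.Subgraph, M.IsMatching → M.edgeSet.ncard = k →
    ∃ P : G.Subgraph, P.IsPerfectMatching ∧ M ≤ P

/-- The Harary graph `H_{2r,ν}`: the circulant graph on `ZMod ν` with
connection set `{±1, …, ±r}`. -/
def hararyEven (r ν : ℕ) : SimpleGraph (ZMod ν) :=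
  SimpleGraph.fromRel (fun i j => ∃ t : ℕ, 1 ≤ t ∧ t ≤ r ∧ j = i + (t : ZMod ν))

/-- If `f` embeds a finite set `T` of even size and sends consecutive elements of `T` to adjacent
vertices, so that the image of `T` carries a Hamiltonian path, then that image is the vertex set
of a matching. -/
theorem exists_isMatching_verts_eq_image {α V : Type*} [LinearOrder α] {G : SimpleGraph V}
    {f : α → V} (T : Finset α) (hT : Even T.card) (hf : Set.InjOn f T)
    (hadj : ∀ a ∈ T, ∀ b ∈ T, a < b → (∀ x ∈ T, x ≤ a ∨ b ≤ x) → G.Adj (f a) (f b)) :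
    ∃ M : G.Subgraph, M.IsMatching ∧ M.verts = f '' T := by
  induction hn : T.card using Nat.strong_induction_on generalizing T with
  | _ n ih =>
  subst hn
  rcases T.eq_empty_or_nonempty with rfl | hne
  · exact ⟨⊥, fun v hv => by simp at hv, by simp⟩
  set a := T.min' hne
  have ha : a ∈ T := T.min'_mem hne
  have hcard := Finset.card_erase_of_mem ha
  have hpos := Finset.card_pos.mpr hne
  obtain ⟨k, hk⟩ := hT
  have hne' : (T.erase a).Nonempty := Finset.card_pos.mp (by omega)
  set b := (T.erase a).min' hne'
  have hb' : b ∈ T.erase a := (T.erase a).min'_mem hne'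
  have hb : b ∈ T := Finset.mem_of_mem_erase hb'
  have hcard' := Finset.card_erase_of_mem hb'
  have hle : ∀ x ∈ T, x ≤ a ∨ b ≤ x := by
    intro x hx
    by_cases h : x = a
    · exact .inl h.le
    · exact .inr ((T.erase a).min'_le x (Finset.mem_erase.mpr ⟨h, hx⟩))
  have hab : a < b := lt_of_le_of_ne (T.min'_le b hb) (Finset.ne_of_mem_erase hb').symm
  have hG := hadj a ha b hb hab hle
  have hsub : (T.erase a).erase b ⊆ T := (Finset.erase_subset _ _).trans (Finset.erase_subset _ _)
  obtain ⟨M, hM, hMv⟩ := ih _ (by omega) ((T.erase a).erase b) ⟨k - 1, by omega⟩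
    (hf.mono (Finset.coe_subset.mpr hsub))
    (fun x hx y hy hxy h => hadj x (hsub hx) y (hsub hy) hxy fun z hz => by
      by_cases hzb : z ≤ b
      · refine .inl (hzb.trans ?_)
        simp only [Finset.mem_erase] at hx
        exact (hle x hx.2.2).resolve_left fun h =>
          hx.2.1 (h.antisymm (T.min'_le x hx.2.2))
      · exact h z (Finset.mem_erase.mpr ⟨fun e => hzb e.le,
          Finset.mem_erase.mpr ⟨fun e => hzb (e ▸ hab.le), hz⟩⟩)) rfl
  refine ⟨G.subgraphOfAdj hG ⊔ M, (Subgraph.IsMatching.subgraphOfAdj hG).sup hM ?_, ?_⟩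
  · rw [(Subgraph.IsMatching.subgraphOfAdj hG).support_eq_verts, hM.support_eq_verts, hMv,
      Set.disjoint_left]
    rintro _ h ⟨x, hx, rfl⟩
    simp only [Finset.coe_erase, Set.mem_sdiff, Set.mem_singleton_iff, Finset.mem_coe] at hx
    rcases h with h | h
    · exact hx.1.2 (hf hx.1.1 ha h)
    · exact hx.2 (hf hx.1.1 hb h)
  · rw [Subgraph.verts_sup, hMv, subgraphOfAdj_verts, ← Set.image_pair, ← Set.image_union]
    congr 1
    ext x
    simp only [Finset.coe_erase, Set.mem_union, Set.mem_insert_iff, Set.mem_singleton_iff,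
      Set.mem_sdiff, Finset.mem_coe]
    grind

theorem hararyEven_isFactorCritical_of_odd (r ν : ℕ) (hr : 2 ≤ r) (hν : 2 * r < ν)
    (hodd : Odd ν) : IsFactorCritical (hararyEven r ν) (2 * r - 1) := by
  intro S hS
  have : NeZero ν := ⟨by omega⟩
  obtain ⟨c, hc⟩ : ∃ c : ZMod ν, (∀ k < r, c + (k : ZMod ν) ∈ S) ∨
      ∀ d : ZMod ν, ∃ k < r, d + (k : ZMod ν) ∉ S := by
    by_cases h : ∃ c : ZMod ν, ∀ k < r, c + (k : ZMod ν) ∈ S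
    · exact h.imp fun _ => .inl
    · push Not at h
      exact ⟨0, .inr h⟩
  set f : ℕ → ZMod ν := fun k => c + (k : ZMod ν) with hf
  have hinj : Set.InjOn f (Finset.range ν) := by
    intro x hx y hy hxy
    have h := add_left_cancel hxy
    rw [ZMod.natCast_eq_natCast_iff'] at h
    rwa [Nat.mod_eq_of_lt (by simpa using hx), Nat.mod_eq_of_lt (by simpa using hy)] at h
  set T := (Finset.range ν).filter fun k => f k ∉ S with hT
  have hTinj : Set.InjOn f T := hinj.mono (Finset.coe_subset.mpr (Finset.filter_subset _ _))
  have himage : T.image f = Sᶜ := by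
    ext v
    simp only [hT, Finset.mem_image, Finset.mem_filter, Finset.mem_range, Finset.mem_compl]
    constructor
    · rintro ⟨k, ⟨-, hk⟩, rfl⟩
      exact hk
    · intro hv
      have hfv : f (v - c).val = v := by simp [hf]
      exact ⟨(v - c).val, ⟨ZMod.val_lt _, hfv.symm ▸ hv⟩, hfv⟩
  have hcard : T.card = ν - (2 * r - 1) := by
    rw [← Finset.card_image_of_injOn hTinj, himage, Finset.card_compl, ZMod.card, hS]
  have heven : Even T.card := by
    rw [hcard]
    grind
  have hgap : ∀ a ∈ T, ∀ b ∈ T, a < b → (∀ x ∈ T, x ≤ a ∨ b ≤ x) → b - a ≤ r := by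
    intro a ha b hb hab h
    by_contra! hr'
    simp only [hT, Finset.mem_filter, Finset.mem_range] at ha hb h
    have hrun : ∀ x, a < x → x < b → f x ∈ S := by
      intro x hax hxb
      by_contra hx
      have := h x ⟨by omega, hx⟩
      omega
    rcases hc with hc | hc
    · have har : r ≤ a := by
        by_contra! har
        exact ha.2 (hc a har)
      have hsub : (Finset.range r ∪ Finset.Ioc a (a + r)).image f ⊆ S := by
        intro v hv
        simp only [Finset.mem_image, Finset.mem_union, Finset.mem_range, Finset.mem_Ioc] at hv
        obtain ⟨x, hx | hx, rfl⟩ := hv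
        · exact hc x hx
        · exact hrun x hx.1 (by omega)
      have hle := Finset.card_le_card hsub
      rw [Finset.card_image_of_injOn (hinj.mono fun x hx => by simp at hx ⊢; omega),
        Finset.card_union_of_disjoint (Finset.disjoint_left.mpr fun x hx hx' => by
          simp at hx hx'; omega), Finset.card_range, Nat.card_Ioc, hS] at hle
      omega
    · obtain ⟨k, hk, hkS⟩ := hc (f (a + 1))
      refine hkS ?_
      have := hrun (a + 1 + k) (by omega) (by omega)
      simpa [hf, add_assoc] using this
  obtain ⟨M, hM, hMv⟩ := exists_isMatching_verts_eq_image (G := hararyEven r ν) T heven hTinj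
    fun a ha b hb hab h => by
      rw [hararyEven, fromRel_adj]
      refine ⟨fun e => hab.ne (hTinj ha hb e), .inl ⟨b - a, by omega, hgap a ha b hb hab h, ?_⟩⟩
      simp only [hf]
      rw [Nat.cast_sub hab.le]
      ring
  exact ⟨M, hM, by rw [hMv, ← Finset.coe_image, himage, Finset.coe_compl]⟩
end

section
/- Let r ≥ 2 and ν > 2r+1 be integers with ν even. Then the Harary graph H_{2r+1,ν} is 2r-factor-critical. -/
open SimpleGraph

/-- The Harary graph `H_{2r+1,ν}` for even `ν`: the circulant graph on `ZMod ν`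
with connection set `{±1, …, ±r, ν/2}`. -/
def hararyOddHalf (r ν : ℕ) : SimpleGraph (ZMod ν) :=
  SimpleGraph.fromRel (fun i j =>
    (∃ t : ℕ, 1 ≤ t ∧ t ≤ r ∧ j = i + (t : ZMod ν)) ∨ j = i + ((ν / 2 : ℕ) : ZMod ν))

theorem Set.InjOn.disjoint_image_image {α β : Type*} {f : α → β} {u s t : Set α}
    (hf : u.InjOn f) (hs : s ⊆ u) (ht : t ⊆ u) (hd : Disjoint s t) :
    Disjoint (f '' s) (f '' t) :=
  Set.disjoint_image_image fun _ hx _ hy he =>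
    Set.disjoint_left.1 hd hx (hf (hs hx) (ht hy) he ▸ hy)

namespace SimpleGraph

variable {V : Type*} {G : SimpleGraph V}

/-- The vertex set `s` is spanned by a matching of `G`. -/
def IsMatchable (G : SimpleGraph V) (s : Set V) : Prop :=
  ∃ M : G.Subgraph, M.IsMatching ∧ M.verts = s

theorem isMatchable_empty : G.IsMatchable ∅ :=
  ⟨⊥, fun _ h => h.elim, rfl⟩

theorem isMatchable_pair {u v : V} (h : G.Adj u v) : G.IsMatchable {u, v} :=
  ⟨G.subgraphOfAdj h, Subgraph.IsMatching.subgraphOfAdj h, rfl⟩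

theorem IsMatchable.union {s t : Set V} (hs : G.IsMatchable s) (ht : G.IsMatchable t)
    (hd : Disjoint s t) : G.IsMatchable (s ∪ t) := by
  obtain ⟨M, hM, rfl⟩ := hs
  obtain ⟨N, hN, rfl⟩ := ht
  refine ⟨M ⊔ N, hM.sup hN ?_, rfl⟩
  rwa [hM.support_eq_verts, hN.support_eq_verts]

/-- If `f` places the points of an even-size set `T` of naturals so that points at distance at
most `r` are adjacent, and consecutive points of `T` are at distance at most `r`, then pairing
them off consecutively gives a matching. -/
theorem isMatchable_image_of_gaps_le (f : ℕ → V) (r : ℕ) (T : Finset ℕ) (heven : Even T.card)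
    (hinj : Set.InjOn f T)
    (hadj : ∀ i ∈ T, ∀ j ∈ T, i < j → j ≤ i + r → G.Adj (f i) (f j))
    (hgap : ∀ i ∈ T, ∀ k ∈ T, i < k → ∃ j ∈ T, i < j ∧ j ≤ i + r) :
    G.IsMatchable (f '' T) := by
  induction hn : T.card using Nat.strong_induction_on generalizing T with
  | _ n ih =>
  rcases T.eq_empty_or_nonempty with rfl | hne
  · simpa using isMatchable_empty
  have hx := T.min'_mem hne
  set x := T.min' hne
  have hxmin : ∀ z ∈ T, x ≤ z := fun z hz => T.min'_le z hz
  have hcard := Finset.card_erase_of_mem hx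
  have hpos := Finset.card_pos.2 hne
  have hne' : (T.erase x).Nonempty := by
    rw [← Finset.card_pos, hcard]
    obtain ⟨c, hc⟩ := heven
    omega
  have hy := (T.erase x).min'_mem hne'
  set y := (T.erase x).min' hne'
  have hymin : ∀ z ∈ T, z ≠ x → y ≤ z := fun z hz hzx =>
    (T.erase x).min'_le z (Finset.mem_erase.2 ⟨hzx, hz⟩)
  have hcard' := Finset.card_erase_of_mem hy
  have hpos' := Finset.card_pos.2 hne'
  obtain ⟨hyx, hyT⟩ := Finset.mem_erase.1 hy
  have hxy : x < y := lt_of_le_of_ne (hxmin y hyT) (Ne.symm hyx)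
  have hsub : ∀ z ∈ (T.erase x).erase y, z ∈ T := fun z hz =>
    Finset.mem_of_mem_erase (Finset.mem_of_mem_erase hz)
  have hyr : y ≤ x + r := by
    obtain ⟨j, hj, h1, h2⟩ := hgap x hx y hyT hxy
    exact (hymin j hj h1.ne').trans h2
  have hrest : G.IsMatchable (f '' ((T.erase x).erase y : Finset ℕ)) := by
    refine ih _ (by omega) _ ?_ (hinj.mono hsub)
      (fun i hi j hj => hadj i (hsub i hi) j (hsub j hj)) ?_ rfl
    · obtain ⟨c, hc⟩ := heven
      exact ⟨c - 1, by omega⟩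
    · intro i hi k hk hik
      obtain ⟨j, hj, h1, h2⟩ := hgap i (hsub i hi) k (hsub k hk) hik
      have hi' := Finset.mem_erase.1 hi
      have hyi := hymin i (hsub i hi) (Finset.mem_erase.1 hi'.2).1
      exact ⟨j, by simp only [Finset.mem_erase]; exact ⟨by omega, by omega, hj⟩, h1, h2⟩
  have hT : (T : Set ℕ) = {x, y} ∪ (((T.erase x).erase y : Finset ℕ) : Set ℕ) := by
    ext z
    simp only [Finset.coe_erase, Set.mem_union, Set.mem_insert_iff, Set.mem_singleton_iff,
      Set.mem_sdiff, Finset.mem_coe]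
    by_cases h1 : z = x <;> by_cases h2 : z = y <;> simp_all
  have hd : Disjoint ({x, y} : Set ℕ) ((T.erase x).erase y : Finset ℕ) := by
    rw [Set.disjoint_left]
    rintro z (rfl | rfl) <;> simp
  rw [hT, Set.image_union]
  refine IsMatchable.union ?_ hrest ?_
  · rw [Set.image_pair]
    exact isMatchable_pair (hadj x hx y hyT hxy hyr)
  · refine hinj.disjoint_image_image ?_ hsub hd
    rintro z (rfl | rfl)
    exacts [hx, hyT]

end SimpleGraph

namespace HararyOdd

variable {r ν : ℕ}

/-- The enumeration of `ZMod ν` starting just after `x`. -/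
def walk (x : ZMod ν) (i : ℕ) : ZMod ν := x + 1 + i

theorem walk_injOn (x : ZMod ν) : Set.InjOn (walk x) (Set.Iio ν) := by
  intro i hi j hj h
  have h' : (i : ZMod ν) = j := add_left_cancel h
  rw [ZMod.natCast_eq_natCast_iff'] at h'
  rwa [Nat.mod_eq_of_lt hi, Nat.mod_eq_of_lt hj] at h'

theorem exists_walk_eq [NeZero ν] (x z : ZMod ν) : ∃ i < ν, walk x i = z :=
  ⟨(z - x - 1).val, ZMod.val_lt _, by simp [walk]⟩

theorem walk_last [NeZero ν] (x : ZMod ν) : walk x (ν - 1) = x := by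
  have : ((ν - 1 : ℕ) : ZMod ν) = -1 := by
    rw [Nat.cast_sub (Nat.one_le_iff_ne_zero.2 (NeZero.ne ν))]
    simp
  simp [walk, this]

theorem walk_add (x : ZMod ν) (i t : ℕ) : walk x (i + t) = walk x i + t := by
  simp [walk, add_assoc]

theorem walk_adj (x : ZMod ν) {i j : ℕ} (hj : j < ν) (hij : i < j)
    (h : j ≤ i + r ∨ j = i + ν / 2) : (hararyOddHalf r ν).Adj (walk x i) (walk x j) := by
  obtain ⟨t, rfl⟩ := Nat.exists_eq_add_of_lt hij
  refine (SimpleGraph.fromRel_adj _ _ _).2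
    ⟨fun he => hij.ne (walk_injOn x (hij.trans hj) hj he), Or.inl ?_⟩
  rw [add_assoc, walk_add] at *
  rcases h with h | h
  · exact Or.inl ⟨t + 1, by omega, by omega, rfl⟩
  · refine Or.inr ?_
    rw [show t + 1 = ν / 2 by omega]

theorem isMatchable_walk (x : ZMod ν) (T : Finset ℕ) (heven : Even T.card)
    (hT : ∀ i ∈ T, i < ν) (hgap : ∀ i ∈ T, ∀ k ∈ T, i < k → ∃ j ∈ T, i < j ∧ j ≤ i + r) :
    (hararyOddHalf r ν).IsMatchable (walk x '' T) :=
  isMatchable_image_of_gaps_le _ r T heven ((walk_injOn x).mono hT)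
    (fun _ _ j hj hij h => walk_adj x (hT j hj) hij (Or.inl h)) hgap

/-- Two arcs, one from `r` to `y` and one from `y + r + 1` to `ν - 1`, are jointly matchable. -/
theorem isMatchable_two_arcs (hr : 2 ≤ r) (heven : Even ν) (x : ZMod ν) {y : ℕ} (hry : r ≤ y)
    (hy : y + r + 1 < ν) :
    (hararyOddHalf r ν).IsMatchable
      (walk x '' (Finset.Icc r y ∪ Finset.Icc (y + r + 1) (ν - 1) : Finset ℕ)) := by
  obtain ⟨n, hn⟩ := heven
  rcases Nat.even_or_odd (y + 1 - r) with ⟨c, hc⟩ | ⟨c, hc⟩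
  · rw [Finset.coe_union, Set.image_union]
    refine IsMatchable.union ?_ ?_ ((walk_injOn x).disjoint_image_image ?_ ?_ ?_)
    · refine isMatchable_walk x _ ⟨c, by simpa using hc⟩ ?_ ?_
      · simp only [Finset.mem_Icc]; omega
      · simp only [Finset.mem_Icc]; exact fun i _ k _ _ => ⟨i + 1, by omega⟩
    · refine isMatchable_walk x _ ⟨n - r - c, by rw [Nat.card_Icc]; omega⟩ ?_ ?_
      · simp only [Finset.mem_Icc]; omega
      · simp only [Finset.mem_Icc]; exact fun i _ k _ _ => ⟨i + 1, by omega⟩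
    · intro i; simp only [Finset.mem_coe, Finset.mem_Icc, Set.mem_Iio]; omega
    · intro i; simp only [Finset.mem_coe, Finset.mem_Icc, Set.mem_Iio]; omega
    · rw [Finset.disjoint_coe, Finset.disjoint_left]
      intro i; simp only [Finset.mem_Icc]; omega
  · -- Both arcs are odd, and their midpoints `m` and `m + ν / 2` are antipodal.
    set m := r + c
    have hstep : ∀ p a b : ℕ, ∀ i ∈ (Finset.Icc a b).erase p, ∀ k ∈ (Finset.Icc a b).erase p,
        i < k → ∃ j ∈ (Finset.Icc a b).erase p, i < j ∧ j ≤ i + r := by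
      simp only [Finset.mem_erase, Finset.mem_Icc]
      intro p a b i hi k hk hik
      by_cases h : i + 1 = p
      · exact ⟨i + 2, by omega⟩
      · exact ⟨i + 1, by omega⟩
    have hB : (hararyOddHalf r ν).IsMatchable (walk x '' ((Finset.Icc r y).erase m)) := by
      refine isMatchable_walk x _ ⟨c, ?_⟩ ?_ (hstep _ _ _)
      · rw [Finset.card_erase_of_mem (by simp only [Finset.mem_Icc]; omega), Nat.card_Icc]
        omega
      · simp only [Finset.mem_erase, Finset.mem_Icc]; omega
    have hA : (hararyOddHalf r ν).IsMatchable
        (walk x '' ((Finset.Icc (y + r + 1) (ν - 1)).erase (m + ν / 2))) := by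
      refine isMatchable_walk x _ ⟨n - r - c - 1, ?_⟩ ?_ (hstep _ _ _)
      · rw [Finset.card_erase_of_mem (by simp only [Finset.mem_Icc]; omega), Nat.card_Icc]
        omega
      · simp only [Finset.mem_erase, Finset.mem_Icc]; omega
    have hmid : (hararyOddHalf r ν).IsMatchable (walk x '' ({m, m + ν / 2} : Finset ℕ)) := by
      rw [Finset.coe_pair, Set.image_pair]
      exact isMatchable_pair (walk_adj x (by omega) (by omega) (Or.inr rfl))
    have hun : Finset.Icc r y ∪ Finset.Icc (y + r + 1) (ν - 1) =
        ((Finset.Icc r y).erase m ∪ (Finset.Icc (y + r + 1) (ν - 1)).erase (m + ν / 2)) ∪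
          {m, m + ν / 2} := by
      ext i
      simp only [Finset.mem_union, Finset.mem_erase, Finset.mem_Icc, Finset.mem_insert,
        Finset.mem_singleton]
      omega
    rw [hun, Finset.coe_union, Set.image_union, Finset.coe_union, Set.image_union]
    refine (hB.union hA ((walk_injOn x).disjoint_image_image ?_ ?_ ?_)).union hmid ?_
    · intro i
      simp only [Finset.mem_coe, Finset.mem_erase, Finset.mem_Icc, Set.mem_Iio]; omega
    · intro i
      simp only [Finset.mem_coe, Finset.mem_erase, Finset.mem_Icc, Set.mem_Iio]; omega
    · rw [Finset.disjoint_coe, Finset.disjoint_left]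
      intro i; simp only [Finset.mem_erase, Finset.mem_Icc]; omega
    · rw [← Set.image_union, ← Finset.coe_union]
      refine (walk_injOn x).disjoint_image_image ?_ ?_ ?_
      · intro i
        simp only [Finset.mem_coe, Finset.mem_union, Finset.mem_erase, Finset.mem_Icc,
          Set.mem_Iio]
        omega
      · intro i
        simp only [Finset.mem_coe, Finset.mem_insert, Finset.mem_singleton, Set.mem_Iio]
        omega
      · rw [Finset.disjoint_coe, Finset.disjoint_left]
        intro i
        simp only [Finset.mem_union, Finset.mem_erase, Finset.mem_Icc, Finset.mem_insert,
          Finset.mem_singleton]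
        omega

theorem isMatchable_compl_of_at_most_one_long_gap [NeZero ν] (S : Finset (ZMod ν))
    (hS : Even S.card) (heven : Even ν) (x : ZMod ν) (hx : x ∉ S)
    (hother : ∀ y ∉ S, y ≠ x → ∃ t, 1 ≤ t ∧ t ≤ r ∧ y + (t : ZMod ν) ∉ S) :
    (hararyOddHalf r ν).IsMatchable (↑S : Set (ZMod ν))ᶜ := by
  classical
  have hpos := Nat.pos_of_neZero ν
  set T := (Finset.range ν).filter (fun i => walk x i ∉ S) with hTdef
  have hTlt : ∀ i ∈ T, i < ν := fun i hi => Finset.mem_range.1 (Finset.mem_filter.1 hi).1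
  have himage : T.image (walk x) = Sᶜ := by
    ext z
    simp only [hTdef, Finset.mem_image, Finset.mem_filter, Finset.mem_range, Finset.mem_compl]
    constructor
    · rintro ⟨i, ⟨-, hi⟩, rfl⟩
      exact hi
    · intro hz
      obtain ⟨i, hi, rfl⟩ := exists_walk_eq x z
      exact ⟨i, ⟨hi, hz⟩, rfl⟩
  have hcard : T.card = ν - S.card := by
    rw [← Finset.card_image_of_injOn ((walk_injOn x).mono hTlt), himage, Finset.card_compl,
      ZMod.card]
  have hlast : ν - 1 ∈ T := by simp [hTdef, walk_last, hx, hpos]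
  rw [← Finset.coe_compl, ← himage, Finset.coe_image]
  refine isMatchable_walk x T (hcard ▸ heven.tsub hS) hTlt fun i hi k hk hik => ?_
  have hk' := hTlt k hk
  have hne : walk x i ≠ x := fun h => by
    have := walk_injOn x (hTlt i hi) (hTlt _ hlast) (h.trans (walk_last x).symm)
    omega
  obtain ⟨t, ht1, htr, ht⟩ := hother _ (Finset.mem_filter.1 hi).2 hne
  rcases le_or_gt ν (i + t) with h | h
  · exact ⟨ν - 1, hlast, by omega, by omega⟩
  · exact ⟨i + t, Finset.mem_filter.2 ⟨Finset.mem_range.2 h, by rwa [walk_add]⟩, by omega,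
      by omega⟩

theorem isMatchable_compl_of_two_long_gaps [NeZero ν] (hr : 2 ≤ r) (heven : Even ν)
    (S : Finset (ZMod ν)) (hS : S.card = 2 * r) (x y : ZMod ν) (hx : x ∉ S) (hy : y ∉ S)
    (hyx : y ≠ x) (hgx : ∀ t : ℕ, 1 ≤ t → t ≤ r → x + (t : ZMod ν) ∈ S)
    (hgy : ∀ t : ℕ, 1 ≤ t → t ≤ r → y + (t : ZMod ν) ∈ S) :
    (hararyOddHalf r ν).IsMatchable (↑S : Set (ZMod ν))ᶜ := by
  classical
  obtain ⟨k, hk, rfl⟩ := exists_walk_eq x y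
  have hk1 : k ≠ ν - 1 := fun h => hyx (h ▸ walk_last x)
  have hstart : ∀ i < r, walk x i ∈ S := fun i hi => by
    have := hgx (i + 1) (by omega) (by omega)
    rwa [Nat.cast_add, Nat.cast_one, add_comm (i : ZMod ν), ← add_assoc] at this
  have hrk : r ≤ k := not_lt.1 fun h => hy (hstart k h)
  have hkr : k + r + 1 < ν := by
    by_contra! h
    have := hgy (ν - 1 - k) (by omega) (by omega)
    rw [← walk_add, show k + (ν - 1 - k) = ν - 1 by omega, walk_last] at this
    exact hx this
  have hU : ∀ i ∈ Finset.range r ∪ Finset.Icc (k + 1) (k + r), i < ν := by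
    simp only [Finset.mem_union, Finset.mem_range, Finset.mem_Icc]; omega
  have himage : (Finset.range r ∪ Finset.Icc (k + 1) (k + r)).image (walk x) = S := by
    refine Finset.eq_of_subset_of_card_le ?_ ?_
    · intro z
      simp only [Finset.mem_image, Finset.mem_union, Finset.mem_range, Finset.mem_Icc]
      rintro ⟨i, hi | hi, rfl⟩
      · exact hstart i hi
      · obtain ⟨t, rfl⟩ := Nat.exists_eq_add_of_le (show k ≤ i by omega)
        rw [walk_add]
        exact hgy t (by omega) (by omega)
    · rw [Finset.card_image_of_injOn ((walk_injOn x).mono hU), Finset.card_union_of_disjoint,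
        Finset.card_range, Nat.card_Icc, hS]
      · omega
      · rw [Finset.disjoint_left]
        intro i; simp only [Finset.mem_range, Finset.mem_Icc]; omega
  convert isMatchable_two_arcs hr heven x hrk hkr using 1
  ext z
  obtain ⟨i, hi, rfl⟩ := exists_walk_eq x z
  have hmem : walk x i ∈ S ↔ i ∈ Finset.range r ∪ Finset.Icc (k + 1) (k + r) := by
    rw [← himage, ← Finset.mem_coe, Finset.coe_image]
    exact (walk_injOn x).mem_image_iff hU hi
  rw [(walk_injOn x).mem_image_iff _ hi, Set.mem_compl_iff, Finset.mem_coe, hmem]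
  · simp only [Finset.mem_coe, Finset.mem_union, Finset.mem_range, Finset.mem_Icc]; omega
  · intro j
    simp only [Finset.mem_coe, Finset.mem_union, Finset.mem_Icc, Set.mem_Iio]; omega

end HararyOdd

open HararyOdd in
theorem hararyOdd_isFactorCritical_of_even (r ν : ℕ) (hr : 2 ≤ r) (hν : 2 * r + 1 < ν)
    (heven : Even ν) : IsFactorCritical (hararyOddHalf r ν) (2 * r) := by
  intro S hS
  have : NeZero ν := ⟨by omega⟩
  change (hararyOddHalf r ν).IsMatchable (↑S : Set (ZMod ν))ᶜ
  by_cases h : ∃ x ∉ S, ∀ y ∉ S, y ≠ x → ∃ t, 1 ≤ t ∧ t ≤ r ∧ y + (t : ZMod ν) ∉ S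
  · obtain ⟨x, hx, hother⟩ := h
    exact isMatchable_compl_of_at_most_one_long_gap S (hS ▸ even_two_mul r) heven x hx hother
  · push Not at h
    obtain ⟨z, hz⟩ : ∃ z, z ∉ S := by
      by_contra! hall
      have := Finset.card_le_card (fun z _ => hall z : Finset.univ ⊆ S)
      rw [Finset.card_univ, ZMod.card] at this
      omega
    obtain ⟨x, hx, -, hgx⟩ := h z hz
    obtain ⟨y, hy, hyx, hgy⟩ := h x hx
    exact isMatchable_compl_of_two_long_gaps hr heven S hS x y hx hy hyx hgx hgy
end

section
/- Let s ≥ 2 be an even integer. Then the Harary graph H_{3,2s} is bicritical, i.e. 2-factor-critical. -/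
open SimpleGraph

/-- The Harary graph `H_{3,2s}`: the circulant graph on `ZMod (2*s)` with
connection set `{±1, s}`. -/
def hararyThree (s : ℕ) : SimpleGraph (ZMod (2 * s)) :=
  SimpleGraph.fromRel (fun i j => j = i + 1 ∨ j = i + (s : ZMod (2 * s)))

/-- An adjacency-preserving involution on a vertex set gives a matching covering that set. -/
theorem exists_isMatching_of_involution {V : Type*} (G : SimpleGraph V) (A : Set V) (f : V → V)
    (hmem : ∀ x ∈ A, f x ∈ A) (hinv : ∀ x ∈ A, f (f x) = x) (hadj : ∀ x ∈ A, G.Adj x (f x)) :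
    ∃ M : G.Subgraph, M.IsMatching ∧ M.verts = A := by
  refine ⟨{ verts := A, Adj := fun x y => x ∈ A ∧ y = f x, adj_sub := ?_, edge_vert := ?_,
            symm := ?_ }, ?_, rfl⟩
  · rintro x y ⟨hx, rfl⟩
    exact hadj x hx
  · rintro x y ⟨hx, -⟩
    exact hx
  · exact ⟨fun x y ⟨hx, hy⟩ => by subst hy; exact ⟨hmem x hx, (hinv x hx).symm⟩⟩
  · intro x hx
    exact ⟨f x, ⟨hx, rfl⟩, fun y hy => hy.2⟩

/-- Positions `1, …, 2s - 1` other than `d` can be paired by steps of length `1` or `s`. -/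
theorem exists_pairing_of_even {s d : ℕ} (heven : Even s) (hd : 0 < d) (hds : d ≤ s) :
    ∃ g : ℕ → ℕ, ∀ n < 2 * s, n ≠ 0 → n ≠ d →
      g n < 2 * s ∧ g n ≠ 0 ∧ g n ≠ d ∧ g (g n) = n ∧
        (g n = n + 1 ∨ n = g n + 1 ∨ g n = n + s ∨ n = g n + s) := by
  rw [Nat.even_iff] at heven
  rcases Nat.mod_two_eq_zero_or_one d with h | h
  · refine ⟨fun n => if n = 1 then s + 1 else if n = s + 1 then 1 else
      if d < n ∧ n ≤ s then (if n % 2 = 0 then n - 1 else n + 1)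
      else (if n % 2 = 0 then n + 1 else n - 1), fun n hn h0 hnd => ?_⟩
    dsimp only
    refine ⟨?_, ?_, ?_, ?_, ?_⟩ <;> split_ifs <;> omega
  · refine ⟨fun n => if n < d then (if n % 2 = 0 then n - 1 else n + 1)
      else (if n % 2 = 0 then n + 1 else n - 1), fun n hn h0 hnd => ?_⟩
    dsimp only
    refine ⟨?_, ?_, ?_, ?_, ?_⟩ <;> split_ifs <;> omega

theorem hararyThree_adj_add_natCast {s m n : ℕ} (hs : 0 < s) (u : ZMod (2 * s))
    (hm : m < 2 * s) (hn : n < 2 * s) (h : n = m + 1 ∨ m = n + 1 ∨ n = m + s ∨ m = n + s) :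
    (hararyThree s).Adj (u + m) (u + n) := by
  rw [hararyThree, SimpleGraph.fromRel_adj]
  constructor
  · intro he
    have := congrArg ZMod.val (add_left_cancel he)
    rw [ZMod.val_natCast_of_lt hm, ZMod.val_natCast_of_lt hn] at this
    omega
  · rcases h with rfl | rfl | rfl | rfl <;> push_cast <;> simp [add_assoc]

theorem exists_isMatching_compl_pair {s : ℕ} (heven : Even s) (u v : ZMod (2 * s))
    (huv : u ≠ v) (hle : (v - u).val ≤ s) (hs : 0 < s) :
    ∃ M : (hararyThree s).Subgraph, M.IsMatching ∧ M.verts = ({u, v} : Set (ZMod (2 * s)))ᶜ := by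
  have : NeZero (2 * s) := ⟨by omega⟩
  obtain ⟨g, hg⟩ := exists_pairing_of_even heven
    (ZMod.val_pos.2 (sub_ne_zero.2 huv.symm)) hle
  have key : ∀ x ∈ ({u, v} : Set (ZMod (2 * s)))ᶜ,
      (x - u).val ≠ 0 ∧ (x - u).val ≠ (v - u).val := by
    intro x hx
    simp only [Set.mem_compl_iff, Set.mem_insert_iff, Set.mem_singleton_iff, not_or] at hx
    refine ⟨fun h => hx.1 (sub_eq_zero.1 ((ZMod.val_eq_zero _).1 h)), fun h => hx.2 ?_⟩
    exact sub_left_injective (ZMod.val_injective _ h)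
  refine exists_isMatching_of_involution _ _ (fun x => u + (g (x - u).val : ℕ)) ?_ ?_ ?_ <;>
    intro x hx <;>
    obtain ⟨h1, h2, h3, h4, h5⟩ := hg _ (ZMod.val_lt (x - u)) (key x hx).1 (key x hx).2
  · have hval := ZMod.val_natCast_of_lt h1
    simp only [Set.mem_compl_iff, Set.mem_insert_iff, Set.mem_singleton_iff, not_or]
    constructor
    · intro h
      rw [add_eq_left.1 h, ZMod.val_zero] at hval
      exact h2 hval.symm
    · intro h
      rw [← h, add_sub_cancel_left, hval] at h3
      exact h3 rfl
  · simp only [add_sub_cancel_left, ZMod.val_natCast_of_lt h1, h4, ZMod.natCast_zmod_val,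
      add_sub_cancel]
  · simpa using hararyThree_adj_add_natCast hs u (ZMod.val_lt (x - u)) h1 h5

theorem hararyThree_bicritical (s : ℕ) (hs : 2 ≤ s) (heven : Even s) :
    IsFactorCritical (hararyThree s) 2 := by
  intro S hS
  obtain ⟨u, v, huv, rfl⟩ := Finset.card_eq_two.1 hS
  have : NeZero (2 * s) := ⟨by omega⟩
  rw [Finset.coe_pair]
  rcases le_total (v - u).val s with h | h
  · exact exists_isMatching_compl_pair heven u v huv h (by omega)
  · rw [Set.pair_comm]
    refine exists_isMatching_compl_pair heven v u huv.symm ?_ (by omega)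
    have : NeZero (v - u) := ⟨sub_ne_zero.2 huv.symm⟩
    rw [← neg_sub, ZMod.val_neg_of_ne_zero]
    omega
end

section
/- Let s ≥ 3 be an odd integer. Then the Harary graph H_{3,2s} is 2-extendable. -/
open SimpleGraph

/-- The subgraph pairing every vertex with its image under an involution moving along edges. -/
def involutionSubgraph {V : Type*} (G : SimpleGraph V) (f : V → V)
    (hadj : ∀ v, G.Adj v (f v)) (hf : Function.Involutive f) : G.Subgraph where
  verts := Set.univ
  Adj v w := w = f v
  adj_sub := by
    rintro v w rfl
    exact hadj v
  edge_vert _ := Set.mem_univ _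
  symm := ⟨by
    rintro v w rfl
    exact (hf v).symm⟩

theorem involutionSubgraph_isPerfectMatching {V : Type*} (G : SimpleGraph V) (f : V → V)
    (hadj : ∀ v, G.Adj v (f v)) (hf : Function.Involutive f) :
    (involutionSubgraph G f hadj hf).IsPerfectMatching :=
  ⟨fun v _ => ⟨f v, rfl, fun _ h => h⟩, fun _ => Set.mem_univ _⟩

theorem hararyThree_natCast_add_self (s : ℕ) : (s : ZMod (2 * s)) + s = 0 := by
  have h : ((2 * s : ℕ) : ZMod (2 * s)) = 0 := ZMod.natCast_self _
  rw [Nat.cast_mul, Nat.cast_two] at h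
  exact (two_mul _).symm.trans h

theorem hararyThree_natCast_ne_one {s : ℕ} (hs : 3 ≤ s) : (s : ZMod (2 * s)) ≠ 1 := by
  intro h
  have h' : ((s : ℕ) : ZMod (2 * s)) = ((1 : ℕ) : ZMod (2 * s)) := by simpa using h
  rw [ZMod.natCast_eq_natCast_iff', Nat.mod_eq_of_lt (by omega), Nat.mod_eq_of_lt (by omega)] at h'
  omega

theorem hararyThree_natCast_add_one_ne_zero {s : ℕ} (hs : 3 ≤ s) :
    (s : ZMod (2 * s)) + 1 ≠ 0 := by
  intro h
  have h' : ((s + 1 : ℕ) : ZMod (2 * s)) = 0 := by simpa using h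
  rw [ZMod.natCast_eq_zero_iff] at h'
  have := Nat.le_of_dvd (by omega) h'
  omega

/-- Reduction modulo two of the vertices of the Harary graph. -/
def hararyThreeParity (s : ℕ) : ZMod (2 * s) →+* ZMod 2 :=
  ZMod.castHom (dvd_mul_right 2 s) (ZMod 2)

theorem hararyThreeParity_natCast {s : ℕ} (hodd : Odd s) :
    hararyThreeParity s (s : ZMod (2 * s)) = 1 := by
  rw [map_natCast]
  exact ZMod.natCast_eq_one_iff_odd.mpr hodd

theorem hararyThree_one_ne_zero (s : ℕ) : (1 : ZMod (2 * s)) ≠ 0 := by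
  intro h
  simpa using congrArg (hararyThreeParity s) h

theorem hararyThree_natCast_ne_zero {s : ℕ} (hodd : Odd s) : (s : ZMod (2 * s)) ≠ 0 := by
  intro h
  simpa [hararyThreeParity_natCast hodd] using congrArg (hararyThreeParity s) h

theorem hararyThree_adj_add_one (s : ℕ) (v : ZMod (2 * s)) : (hararyThree s).Adj v (v + 1) := by
  simp [hararyThree, fromRel_adj, hararyThree_one_ne_zero s]

theorem hararyThree_adj_add_natCast_s5 {s : ℕ} (hodd : Odd s) (v : ZMod (2 * s)) :
    (hararyThree s).Adj v (v + s) := by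
  simp [hararyThree, fromRel_adj, hararyThree_natCast_ne_zero hodd]

theorem hararyThree_connected {s : ℕ} (hs : 3 ≤ s) : (hararyThree s).Connected := by
  have : NeZero (2 * s) := ⟨by omega⟩
  have key (n : ℕ) : (hararyThree s).Reachable 0 (n : ZMod (2 * s)) := by
    induction n with
    | zero => simp
    | succ n ih =>
      rw [Nat.cast_succ]
      exact ih.trans (hararyThree_adj_add_one s _).reachable
  refine (connected_iff_exists_forall_reachable _).mpr ⟨0, fun v => ?_⟩
  simpa using key v.val

theorem hararyThree_exists_isMatching {s : ℕ} (hs : 3 ≤ s) (hodd : Odd s) :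
    ∃ M : (hararyThree s).Subgraph, M.IsMatching ∧ M.edgeSet.ncard = 2 := by
  have h0 := hararyThree_adj_add_natCast_s5 hodd 0
  have h1 := hararyThree_adj_add_natCast_s5 hodd 1
  have e1 := hararyThree_natCast_ne_one hs
  have e2 := hararyThree_natCast_add_one_ne_zero hs
  have e3 := hararyThree_one_ne_zero s
  have e4 := hararyThree_natCast_ne_zero hodd
  have e5 : (s : ZMod (2 * s)) ≠ 1 + s := by simpa using e3
  refine ⟨subgraphOfAdj _ h0 ⊔ subgraphOfAdj _ h1,
    (Subgraph.IsMatching.subgraphOfAdj h0).sup (Subgraph.IsMatching.subgraphOfAdj h1) ?_, ?_⟩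
  · rw [support_subgraphOfAdj, support_subgraphOfAdj, Set.disjoint_left]
    simp only [zero_add, Set.mem_insert_iff, Set.mem_singleton_iff]
    grind
  · rw [Subgraph.edgeSet_sup, edgeSet_subgraphOfAdj, edgeSet_subgraphOfAdj,
      Set.singleton_union, Set.ncard_pair]
    simp only [ne_eq, Sym2.eq_iff]
    grind

/-- A set of rim edges, given by their starting points, extends to a perfect matching by rungs if
its members are pairwise disjoint and the set of vertices it misses is stable under adding `s`. -/
theorem hararyThree_exists_isPerfectMatching {s : ℕ} (hodd : Odd s) (D : Set (ZMod (2 * s)))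
    (hdisj : ∀ v ∈ D, v + 1 ∉ D)
    (hmiss : ∀ v, v ∉ D → v - 1 ∉ D → v + s ∉ D ∧ v + s - 1 ∉ D) :
    ∃ P : (hararyThree s).Subgraph, P.IsPerfectMatching ∧ (∀ v ∈ D, P.Adj v (v + 1)) ∧
      ∀ v, v ∉ D → v - 1 ∉ D → P.Adj v (v + s) := by
  classical
  have hss := hararyThree_natCast_add_self s
  let f (v : ZMod (2 * s)) : ZMod (2 * s) :=
    if v ∈ D then v + 1 else if v - 1 ∈ D then v - 1 else v + s
  have hf : Function.Involutive f := by
    intro v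
    by_cases h1 : v ∈ D
    · simp [f, h1, hdisj v h1]
    · by_cases h2 : v - 1 ∈ D
      · simp [f, h1, h2]
      · simp [f, h1, h2, hmiss v h1 h2, add_assoc, hss]
  have hadj (v : ZMod (2 * s)) : (hararyThree s).Adj v (f v) := by
    simp only [f]
    split_ifs
    · exact hararyThree_adj_add_one s v
    · simpa using (hararyThree_adj_add_one s (v - 1)).symm
    · exact hararyThree_adj_add_natCast_s5 hodd v
  refine ⟨involutionSubgraph _ f hadj hf, involutionSubgraph_isPerfectMatching _ f hadj hf,
    fun v hv => ?_, fun v h1 h2 => ?_⟩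
  · change v + 1 = f v
    simp [f, hv]
  · change v + s = f v
    simp [f, h1, h2]

theorem hararyThree_mem_edgeSet_cases {s : ℕ} {e : Sym2 (ZMod (2 * s))}
    (he : e ∈ (hararyThree s).edgeSet) : ∃ v, e = s(v, v + 1) ∨ e = s(v, v + s) := by
  induction e using Sym2.ind with
  | _ a b =>
    obtain ⟨-, (rfl | rfl) | (rfl | rfl)⟩ := (fromRel_adj _ _ _).mp ((mem_edgeSet _).mp he)
    · exact ⟨a, .inl rfl⟩
    · exact ⟨a, .inr rfl⟩
    · exact ⟨b, .inl Sym2.eq_swap⟩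
    · exact ⟨b, .inr Sym2.eq_swap⟩

theorem SimpleGraph.Subgraph.IsMatching.notMem_of_mem_edgeSet {V : Type*} {G : SimpleGraph V}
    {M : G.Subgraph} (hM : M.IsMatching) {e₁ e₂ : Sym2 V} (h₁ : e₁ ∈ M.edgeSet)
    (h₂ : e₂ ∈ M.edgeSet) (hne : e₁ ≠ e₂) {v : V} (hv : v ∈ e₁) : v ∉ e₂ := by
  intro hv'
  obtain ⟨a, rfl⟩ := Sym2.mem_iff_exists.mp hv
  obtain ⟨b, rfl⟩ := Sym2.mem_iff_exists.mp hv'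
  exact hne (congrArg (fun w => s(v, w)) (hM.eq_of_adj_left h₁ h₂))

theorem hararyThree_exists_isPerfectMatching_rungs {s : ℕ} (hodd : Odd s) (i j : ZMod (2 * s)) :
    ∃ P : (hararyThree s).Subgraph, P.IsPerfectMatching ∧ P.Adj i (i + s) ∧ P.Adj j (j + s) := by
  obtain ⟨P, hP, -, hP'⟩ := hararyThree_exists_isPerfectMatching hodd ∅ (by simp) (by simp)
  exact ⟨P, hP, hP' i (by simp) (by simp), hP' j (by simp) (by simp)⟩

theorem hararyThree_exists_isPerfectMatching_rim_rung {s : ℕ} (hs : 3 ≤ s) (hodd : Odd s)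
    {i j : ZMod (2 * s)} (h : ∀ v ∈ s(i, i + 1), v ∉ s(j, j + (s : ZMod (2 * s)))) :
    ∃ P : (hararyThree s).Subgraph, P.IsPerfectMatching ∧ P.Adj i (i + 1) ∧ P.Adj j (j + s) := by
  have hss := hararyThree_natCast_add_self s
  have e1 := hararyThree_natCast_ne_one hs
  have e2 := hararyThree_natCast_add_one_ne_zero hs
  have e3 := hararyThree_one_ne_zero s
  simp only [Sym2.mem_iff] at h
  have h1 := h i (.inl rfl)
  have h2 := h (i + 1) (.inr rfl)
  obtain ⟨P, hP, hrim, hrung⟩ := hararyThree_exists_isPerfectMatching hodd {i, i + (s : ZMod (2 * s))}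
    (by simp only [Set.mem_insert_iff, Set.mem_singleton_iff]; grind)
    (by simp only [Set.mem_insert_iff, Set.mem_singleton_iff]; grind)
  refine ⟨P, hP, hrim i (by simp), hrung j ?_ ?_⟩ <;>
    simp only [Set.mem_insert_iff, Set.mem_singleton_iff] <;> grind

theorem hararyThree_exists_isPerfectMatching_rims {s : ℕ} (hs : 3 ≤ s) (hodd : Odd s)
    {i j : ZMod (2 * s)} (h : ∀ v ∈ s(i, i + 1), v ∉ s(j, j + 1)) :
    ∃ P : (hararyThree s).Subgraph, P.IsPerfectMatching ∧ P.Adj i (i + 1) ∧ P.Adj j (j + 1) := by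
  have hss := hararyThree_natCast_add_self s
  have e1 := hararyThree_natCast_ne_one hs
  have e2 := hararyThree_natCast_add_one_ne_zero hs
  have e3 := hararyThree_one_ne_zero s
  have hps := hararyThreeParity_natCast hodd
  have htwo : (1 : ZMod 2) + 1 = 0 := by decide
  simp only [Sym2.mem_iff] at h
  have h1 := h i (.inl rfl)
  have h2 := h (i + 1) (.inr rfl)
  by_cases hp : hararyThreeParity s i = hararyThreeParity s j
  · have hcases : ∀ a b : ZMod 2, a ≠ b → a - 1 = b := by decide
    obtain ⟨P, hP, hrim, -⟩ := hararyThree_exists_isPerfectMatching hodd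
      {v | hararyThreeParity s v = hararyThreeParity s i}
      (by intro v hv; simp_all)
      (by
        intro v hv hv'
        simp only [Set.mem_ofPred_eq, map_sub, map_one] at hv hv'
        exact absurd (hcases _ _ hv) hv')
    exact ⟨P, hP, hrim i rfl, hrim j hp.symm⟩
  · have h3 : j ≠ i + s + 1 := by
      rintro rfl
      simp [hps, add_assoc, htwo] at hp
    have h4 : i ≠ j + s + 1 := by
      rintro rfl
      simp [hps, add_assoc, htwo] at hp
    obtain ⟨P, hP, hrim, -⟩ := hararyThree_exists_isPerfectMatching hodd
      {i, i + (s : ZMod (2 * s)), j, j + (s : ZMod (2 * s))}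
      (by simp only [Set.mem_insert_iff, Set.mem_singleton_iff]; grind)
      (by simp only [Set.mem_insert_iff, Set.mem_singleton_iff]; grind)
    exact ⟨P, hP, hrim i (by simp), hrim j (by simp)⟩

theorem hararyThree_exists_isPerfectMatching_of_disjoint_edges {s : ℕ} (hs : 3 ≤ s) (hodd : Odd s)
    {e₁ e₂ : Sym2 (ZMod (2 * s))} (h₁ : e₁ ∈ (hararyThree s).edgeSet)
    (h₂ : e₂ ∈ (hararyThree s).edgeSet) (h : ∀ v ∈ e₁, v ∉ e₂) :
    ∃ P : (hararyThree s).Subgraph, P.IsPerfectMatching ∧ e₁ ∈ P.edgeSet ∧ e₂ ∈ P.edgeSet := by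
  obtain ⟨i, rfl | rfl⟩ := hararyThree_mem_edgeSet_cases h₁ <;>
    obtain ⟨j, rfl | rfl⟩ := hararyThree_mem_edgeSet_cases h₂
  · exact hararyThree_exists_isPerfectMatching_rims hs hodd h
  · exact hararyThree_exists_isPerfectMatching_rim_rung hs hodd h
  · obtain ⟨P, hP, hj, hi⟩ := hararyThree_exists_isPerfectMatching_rim_rung hs hodd
      (fun v hv hv' => h v hv' hv)
    exact ⟨P, hP, hi, hj⟩
  · exact hararyThree_exists_isPerfectMatching_rungs hodd i j

theorem hararyThree_twoExtendable (s : ℕ) (hs : 3 ≤ s) (hodd : Odd s) :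
    IsExtendable (hararyThree s) 2 := by
  refine ⟨hararyThree_connected hs, hararyThree_exists_isMatching hs hodd, fun M hM hcard => ?_⟩
  obtain ⟨e₁, e₂, hne, hE⟩ := Set.ncard_eq_two.mp hcard
  have h₁ : e₁ ∈ M.edgeSet := by simp [hE]
  have h₂ : e₂ ∈ M.edgeSet := by simp [hE]
  obtain ⟨P, hP, hP₁, hP₂⟩ := hararyThree_exists_isPerfectMatching_of_disjoint_edges hs hodd
    (M.edgeSet_subset h₁) (M.edgeSet_subset h₂)
    (fun _ hv => hM.notMem_of_mem_edgeSet h₁ h₂ hne hv)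
  refine ⟨P, hP, fun v _ => hP.2 v, fun v w hvw => ?_⟩
  have hmem : s(v, w) ∈ M.edgeSet := hvw
  rw [hE] at hmem
  change s(v, w) ∈ P.edgeSet
  rcases hmem with h | h
  · rwa [h]
  · rwa [Set.mem_singleton_iff.mp h]
end

section
/- Let n ≥ 1 and ν > n be integers with n ≡ ν (mod 2). Then every n-factor-critical finite simple graph on ν vertices has at least ν(n+1)/2 edges, and there exists an n-factor-critical finite simple graph on ν vertices with exactly ν(n+1)/2 edges. Hence the minimum size of an n-factor-critical graph on ν vertices is exactly ν(n+1)/2. -/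
open SimpleGraph

/-- Some matching of `G` covers exactly the vertices in `s`. -/
def HasMatchingOn {V : Type*} (G : SimpleGraph V) (s : Set V) : Prop :=
  ∃ M : G.Subgraph, M.IsMatching ∧ M.verts = s

namespace HasMatchingOn

variable {V : Type*} {G : SimpleGraph V}

theorem empty : HasMatchingOn G ∅ :=
  ⟨⊥, fun _ hv => hv.elim, rfl⟩

theorem pair {v w : V} (h : G.Adj v w) : HasMatchingOn G {v, w} :=
  ⟨G.subgraphOfAdj h, Subgraph.IsMatching.subgraphOfAdj h, rfl⟩

theorem union {s t : Set V} (hs : HasMatchingOn G s) (ht : HasMatchingOn G t)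
    (hd : Disjoint s t) : HasMatchingOn G (s ∪ t) := by
  obtain ⟨M, hM, rfl⟩ := hs
  obtain ⟨N, hN, rfl⟩ := ht
  exact ⟨M ⊔ N, hM.sup hN (by rwa [hM.support_eq_verts, hN.support_eq_verts]), rfl⟩

/-- Vertices listed in order whose successive gaps are at most `k` can be matched successively,
provided indices at distance at most `k` give adjacent vertices. -/
theorem image_of_gaps_le {f : ℕ → V} {k : ℕ} (T : Finset ℕ) (heven : Even T.card)
    (hinj : Set.InjOn f T)
    (hadj : ∀ x ∈ T, ∀ y ∈ T, x < y → y ≤ x + k → G.Adj (f x) (f y))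
    (hgap : ∀ x ∈ T, ∀ y ∈ T, x < y → ∃ z ∈ T, x < z ∧ z ≤ x + k) :
    HasMatchingOn G (f '' T) := by
  induction hc : T.card using Nat.strong_induction_on generalizing T with
  | _ c ih =>
    rcases T.eq_empty_or_nonempty with rfl | hne
    · simpa using empty
    have ha := T.min'_mem hne
    set a := T.min' hne with ha_def
    have hne' : (T.erase a).Nonempty := by
      rw [← Finset.card_pos, Finset.card_erase_of_mem ha]
      have := Finset.card_pos.2 hne
      obtain ⟨r, hr⟩ := heven
      omega
    have hb := (T.erase a).min'_mem hne'
    set b := (T.erase a).min' hne' with hb_def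
    have hbT := Finset.mem_of_mem_erase hb
    have hab : a < b := lt_of_le_of_ne (T.min'_le b hbT) (Finset.ne_of_mem_erase hb).symm
    have hbk : b ≤ a + k := by
      obtain ⟨z, hz, haz, hzk⟩ := hgap a ha b hbT hab
      exact ((T.erase a).min'_le z (Finset.mem_erase.2 ⟨haz.ne', hz⟩)).trans hzk
    set U := (T.erase a).erase b with hU
    have hUT : U ⊆ T := (Finset.erase_subset _ _).trans (Finset.erase_subset _ _)
    have hcard : U.card + 2 = T.card := by
      rw [hU, Finset.card_erase_of_mem hb, Finset.card_erase_of_mem ha]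
      have := Finset.card_pos.2 hne'
      rw [Finset.card_erase_of_mem ha] at this
      omega
    have hmem : ∀ x ∈ U, b < x := fun x hx =>
      lt_of_le_of_ne ((T.erase a).min'_le x (Finset.mem_of_mem_erase hx))
        (Finset.ne_of_mem_erase hx).symm
    have hmU := ih U.card (by omega) U
      (by rw [← hcard] at heven; simpa [Nat.even_add] using heven)
      (hinj.mono (by exact_mod_cast hUT))
      (fun x hx y hy => hadj x (hUT hx) y (hUT hy))
      (fun x hx y hy hxy => by
        obtain ⟨z, hz, hxz, hzk⟩ := hgap x (hUT hx) y (hUT hy) hxy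
        have := hmem x hx
        exact ⟨z, by simp only [hU, Finset.mem_erase]; exact ⟨by omega, by omega, hz⟩, hxz, hzk⟩)
      rfl
    have hT : f '' (T : Set ℕ) = {f a, f b} ∪ f '' U := by
      have : (T : Set ℕ) = {a, b} ∪ (U : Set ℕ) := by
        ext x
        by_cases hxa : x = a <;> by_cases hxb : x = b <;> simp [hU, hxa, hxb, ha, hbT]
      rw [this, Set.image_union, Set.image_pair]
    rw [hT]
    refine (pair (hadj a ha b hbT hab hbk)).union hmU ?_
    rw [Set.disjoint_left]
    rintro _ hx ⟨y, hy, rfl⟩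
    have hby := hmem y hy
    rcases hx with hx | hx
    · exact absurd (hinj (hUT hy) ha hx) (by omega)
    · exact absurd (hinj (hUT hy) hbT hx) (by omega)

end HasMatchingOn

theorem IsFactorCritical.lt_degree {V : Type*} [Fintype V] {G : SimpleGraph V}
    [DecidableRel G.Adj] {n : ℕ} (h : IsFactorCritical G n) (hn : n < Fintype.card V) (v : V) :
    n < G.degree v := by
  classical
  by_contra! hd
  obtain ⟨S, hNS, hS, hcard⟩ := Finset.exists_subsuperset_card_eq
    (s := G.neighborFinset v) (t := Finset.univ.erase v) (n := n)
    (fun w hw => by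
      rw [mem_neighborFinset] at hw
      simpa using hw.ne')
    hd (by rw [Finset.card_erase_of_mem (Finset.mem_univ v), Finset.card_univ]; omega)
  obtain ⟨M, hM, hverts⟩ := h S hcard
  have hv : v ∈ M.verts := by
    rw [hverts]
    exact fun hvS => Finset.notMem_erase v _ (hS hvS)
  obtain ⟨w, hw, -⟩ := hM hv
  have hwM := hw.snd_mem
  rw [hverts] at hwM
  exact hwM (hNS (by simpa using hw.adj_sub))

theorem IsFactorCritical.card_mul_le {V : Type*} [Fintype V] {G : SimpleGraph V} {n : ℕ}
    (h : IsFactorCritical G n) (hn : n < Fintype.card V) :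
    Fintype.card V * (n + 1) ≤ 2 * G.edgeSet.ncard := by
  classical
  rw [Set.ncard_eq_toFinset_card', ← edgeFinset, ← sum_degrees_eq_twice_card_edges,
    ← smul_eq_mul, ← Finset.card_univ]
  exact Finset.card_nsmul_le_sum _ _ _ fun v _ => h.lt_degree hn v

theorem two_mul_ncard_edgeSet_le {V : Type*} [Fintype V] {G : SimpleGraph V} {d : ℕ}
    (h : ∀ v, (G.neighborSet v).ncard ≤ d) :
    2 * G.edgeSet.ncard ≤ Fintype.card V * d := by
  classical
  rw [Set.ncard_eq_toFinset_card', ← edgeFinset, ← sum_degrees_eq_twice_card_edges,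
    ← smul_eq_mul, ← Finset.card_univ]
  refine Finset.sum_le_card_nsmul _ _ _ fun v _ => ?_
  rw [← card_neighborFinset_eq_degree, neighborFinset, ← Set.ncard_eq_toFinset_card']
  exact h v

section Circulant

variable {ν : ℕ}

theorem ZMod.injOn_add_natCast (c : ZMod ν) :
    Set.InjOn (fun i : ℕ => c + (i : ZMod ν)) (Set.Iio ν) := by
  intro i hi j hj hij
  have := (ZMod.natCast_eq_natCast_iff' i j ν).1 (add_left_cancel hij)
  rwa [Nat.mod_eq_of_lt hi, Nat.mod_eq_of_lt hj] at this

theorem ZMod.exists_lt_add_natCast_eq [NeZero ν] (c v : ZMod ν) : ∃ i < ν, c + (i : ZMod ν) = v :=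
  ⟨(v - c).val, ZMod.val_lt _, by rw [ZMod.natCast_zmod_val, add_sub_cancel]⟩

/-- The circulant graph on `ZMod ν` joining elements whose difference is among `±1, …, ±k` or `±d`
for some `d ∈ E`. -/
def cyclePower (ν k : ℕ) (E : Finset (ZMod ν)) : SimpleGraph (ZMod ν) :=
  circulantGraph ((fun i : ℕ => (i : ZMod ν)) '' Set.Icc 1 k ∪ (E : Set (ZMod ν)))

theorem cyclePower_adj {k : ℕ} {E : Finset (ZMod ν)} {c : ZMod ν} {x y : ℕ} (hxy : x < y)
    (hyk : y ≤ x + k) (hy : y < ν) : (cyclePower ν k E).Adj (c + x) (c + y) := by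
  refine ⟨fun h => ?_, Or.inr (Or.inl ⟨y - x, ⟨by omega, by omega⟩, ?_⟩)⟩
  · have := ZMod.injOn_add_natCast c (hxy.trans hy) hy h
    omega
  · simp [Nat.cast_sub hxy.le]

theorem ncard_neighborSet_cyclePower_le {k : ℕ} {E : Finset (ZMod ν)} (hE : ∀ d ∈ E, -d = d)
    (v : ZMod ν) : ((cyclePower ν k E).neighborSet v).ncard ≤ 2 * k + E.card := by
  classical
  set D : Finset (ZMod ν) := (Finset.Icc 1 k).image fun i : ℕ => v + (i : ZMod ν)
  set D' : Finset (ZMod ν) := (Finset.Icc 1 k).image fun i : ℕ => v - (i : ZMod ν)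
  set F : Finset (ZMod ν) := E.image fun d => v + d
  have hsub : (cyclePower ν k E).neighborSet v ⊆ (D ∪ D' ∪ F : Finset (ZMod ν)) := by
    rintro w ⟨-, (⟨i, hi, hiw⟩ | hw) | (⟨i, hi, hiw⟩ | hw)⟩
    · have : v - (i : ZMod ν) = w := by simp only at hiw; rw [hiw]; ring
      simp only [Finset.coe_union, Set.mem_union, Finset.mem_coe]
      exact Or.inl (Or.inr (Finset.mem_image.2 ⟨i, by simpa using hi, this⟩))
    · have : v + (v - w) = w := by rw [← hE _ hw]; ring
      simp only [Finset.coe_union, Set.mem_union, Finset.mem_coe]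
      exact Or.inr (Finset.mem_image.2 ⟨_, hw, this⟩)
    · have : v + (i : ZMod ν) = w := by simp only at hiw; rw [hiw]; ring
      simp only [Finset.coe_union, Set.mem_union, Finset.mem_coe]
      exact Or.inl (Or.inl (Finset.mem_image.2 ⟨i, by simpa using hi, this⟩))
    · have : v + (w - v) = w := by ring
      simp only [Finset.coe_union, Set.mem_union, Finset.mem_coe]
      exact Or.inr (Finset.mem_image.2 ⟨_, hw, this⟩)
  calc _ ≤ (D ∪ D' ∪ F).card := by
        rw [← Set.ncard_coe_finset]
        exact Set.ncard_le_ncard hsub (Finset.finite_toSet _)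
    _ ≤ D.card + D'.card + F.card :=
        (Finset.card_union_le _ _).trans (Nat.add_le_add_right (Finset.card_union_le _ _) _)
    _ ≤ k + k + E.card := by
        have h1 : D.card ≤ _ := Finset.card_image_le
        have h2 : D'.card ≤ _ := Finset.card_image_le
        have h3 : F.card ≤ _ := Finset.card_image_le
        simp only [Nat.card_Icc] at h1 h2
        omega
    _ = _ := by ring

/-- Deleting at most `2 * k` vertices from the `k`-th power of a cycle leaves a graph with a perfect
matching, unless an odd number of vertices is left or the deleted vertices form two separate
intervals of length `k`. -/
theorem hasMatchingOn_compl_or_eq_image [NeZero ν] {k : ℕ} (E S : Finset (ZMod ν))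
    (hS : S.card ≤ 2 * k) (heven : Even (ν - S.card)) :
    HasMatchingOn (cyclePower ν k E) (S : Set (ZMod ν))ᶜ ∨
      ∃ (c : ZMod ν) (a b : ℕ), 0 < a ∧ 0 < b ∧ a + b + 2 * k = ν ∧ S.card = 2 * k ∧
        (S : Set (ZMod ν))ᶜ =
          (fun i : ℕ => c + (i : ZMod ν)) '' (Set.Iio a ∪ Set.Ico (a + k) (a + k + b)) := by
  classical
  have key : ∀ c : ZMod ν, HasMatchingOn (cyclePower ν k E) (S : Set (ZMod ν))ᶜ ∨
      ∃ x y : ℕ, y < ν ∧ c + (y : ZMod ν) ∉ S ∧ x + k < y ∧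
        ∀ i ∈ Set.Ico (x + 1) (x + k + 1), c + (i : ZMod ν) ∈ S := by
    intro c
    rw [or_iff_not_imp_right]
    intro hno
    set T : Finset ℕ := (Finset.range ν).filter fun i => c + (i : ZMod ν) ∉ S
    have hTmem : ∀ {i}, i ∈ T ↔ i < ν ∧ c + (i : ZMod ν) ∉ S := by simp [T]
    have hinj : Set.InjOn (fun i : ℕ => c + (i : ZMod ν)) T :=
      (ZMod.injOn_add_natCast c).mono fun i hi => (hTmem.1 hi).1
    have himage : T.image (fun i : ℕ => c + (i : ZMod ν)) = Sᶜ := by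
      ext v
      simp only [Finset.mem_image, hTmem, Finset.mem_compl]
      constructor
      · rintro ⟨i, hi, rfl⟩
        exact hi.2
      · intro hv
        obtain ⟨i, hi, rfl⟩ := ZMod.exists_lt_add_natCast_eq c v
        exact ⟨i, ⟨hi, hv⟩, rfl⟩
    have hcard : T.card = ν - S.card := by
      rw [← Finset.card_image_of_injOn hinj, himage, Finset.card_compl, ZMod.card]
    rw [← Finset.coe_compl, ← himage, Finset.coe_image]
    refine HasMatchingOn.image_of_gaps_le (k := k) T (hcard ▸ heven) hinj
      (fun x _ y hy hxy hyk => cyclePower_adj hxy hyk (hTmem.1 hy).1) ?_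
    intro x hx y hy hxy
    by_contra! hz
    refine hno ⟨x, y, (hTmem.1 hy).1, (hTmem.1 hy).2, hz y hy hxy, fun i hi => ?_⟩
    by_contra hiS
    have := hz y hy hxy
    have := (hTmem.1 hy).1
    have := hz i (hTmem.2 ⟨by have := hi.2; omega, hiS⟩) hi.1
    have := hi.2
    omega
  rcases key 0 with h | ⟨x₀, y₀, -, -, -, hrun⟩
  · exact Or.inl h
  set c : ZMod ν := ((x₀ + 1 + k : ℕ) : ZMod ν)
  rcases key c with h | ⟨x, y, hy, hyS, hxy, hx⟩
  · exact Or.inl h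
  right
  have hlast : ∀ i, ν - k ≤ i → i < ν → c + (i : ZMod ν) ∈ S := by
    intro i hi hiν
    have h := hrun (x₀ + 1 + (i + k - ν)) ⟨by omega, by omega⟩
    have hc : c + (i : ZMod ν) = ((x₀ + 1 + (i + k - ν) + ν : ℕ) : ZMod ν) := by
      rw [← Nat.cast_add]
      congr 1
      omega
    rw [hc]
    simpa using h
  have hyk : y < ν - k := by
    by_contra! h
    exact hyS (hlast y h hy)
  set U : Finset ℕ := Finset.Ico (x + 1) (x + 1 + k) ∪ Finset.Ico (ν - k) ν
  have hUmem : ∀ {i}, i ∈ U ↔ (x + 1 ≤ i ∧ i < x + 1 + k) ∨ (ν - k ≤ i ∧ i < ν) := by simp [U]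
  have hUcard : U.card = 2 * k := by
    rw [Finset.card_union_of_disjoint, Nat.card_Ico, Nat.card_Ico]
    · omega
    · rw [Finset.disjoint_left]
      intro i hi hi'
      simp only [Finset.mem_Ico] at hi hi'
      omega
  have hinjU : Set.InjOn (fun i : ℕ => c + (i : ZMod ν)) U :=
    (ZMod.injOn_add_natCast c).mono fun i hi => by
      rcases hUmem.1 hi with h | h
      · exact Set.mem_Iio.2 (by omega)
      · exact h.2
  have hUS : U.image (fun i : ℕ => c + (i : ZMod ν)) = S := by
    refine Finset.eq_of_subset_of_card_le (fun v hv => ?_) ?_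
    · obtain ⟨i, hi, rfl⟩ := Finset.mem_image.1 hv
      rcases hUmem.1 hi with h | h
      · exact hx i ⟨h.1, by omega⟩
      · exact hlast i h.1 h.2
    · rwa [Finset.card_image_of_injOn hinjU, hUcard]
  refine ⟨c, x + 1, ν - 2 * k - x - 1, by omega, by omega, by omega, ?_, ?_⟩
  · rw [← hUS, Finset.card_image_of_injOn hinjU, hUcard]
  ext v
  obtain ⟨i, hi, rfl⟩ := ZMod.exists_lt_add_natCast_eq c v
  rw [← hUS]
  simp only [Finset.coe_image, Set.mem_compl_iff, Set.mem_image, Finset.mem_coe]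
  constructor
  · intro h
    refine ⟨i, ?_, rfl⟩
    have : i ∉ U := fun hiU => h ⟨i, hiU, rfl⟩
    rw [hUmem] at this
    simp only [Set.mem_union, Set.mem_Iio, Set.mem_Ico]
    omega
  · rintro ⟨j, hj, hji⟩ ⟨l, hl, hli⟩
    rw [hUmem] at hl
    simp only [Set.mem_union, Set.mem_Iio, Set.mem_Ico] at hj
    have := ZMod.injOn_add_natCast c (show l < ν by omega) (show j < ν by omega)
      (hli.trans hji.symm)
    omega

theorem isFactorCritical_cyclePower_empty [NeZero ν] {n k : ℕ} (hn : n + 1 = 2 * k)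
    (hpar : Even (ν - n)) :
    IsFactorCritical (cyclePower ν k ∅) n := by
  intro S hS
  rcases hasMatchingOn_compl_or_eq_image (k := k) ∅ S (by omega) (by rwa [hS]) with
    h | ⟨-, -, -, -, -, -, h, -⟩
  · exact h
  · omega

theorem isFactorCritical_cyclePower_antipode [NeZero ν] {k m : ℕ} (hν : ν = 2 * m)
    (hk : 2 ≤ k) :
    IsFactorCritical (cyclePower ν k {(m : ZMod ν)}) (2 * k) := by
  intro S hS
  rcases hasMatchingOn_compl_or_eq_image (k := k) {(m : ZMod ν)} S hS.le
    (by rw [hS, hν, ← Nat.mul_sub]; exact even_two_mul _) with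
    h | ⟨c, a, b, ha, hb, hab, -, hS⟩
  · exact h
  change HasMatchingOn _ _
  rw [hS]
  set f : ℕ → ZMod ν := fun i => c + (i : ZMod ν)
  have hf : Set.InjOn f (Set.Iio ν) := ZMod.injOn_add_natCast c
  have hmatch : ∀ T : Finset ℕ, Even T.card → (∀ x ∈ T, x < ν) →
      (∀ x ∈ T, ∀ y ∈ T, x < y → ∃ z ∈ T, x < z ∧ z ≤ x + k) →
      HasMatchingOn (cyclePower ν k {(m : ZMod ν)}) (f '' T) := fun T hT hlt hgap =>
    HasMatchingOn.image_of_gaps_le T hT (hf.mono hlt)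
      (fun x _ y hy hxy hyk => cyclePower_adj hxy hyk (hlt y hy)) hgap
  have hdisj : ∀ s t : Set ℕ, (∀ x ∈ s, x < ν) → (∀ x ∈ t, x < ν) → Disjoint s t →
      Disjoint (f '' s) (f '' t) := fun s t hs ht hst =>
    hst.image hf hs ht
  rcases Nat.even_or_odd a with hae | hao
  · have hA := hmatch (Finset.range a) (by simpa using hae)
      (fun x hx => by simp only [Finset.mem_range] at hx; omega)
      (fun x hx y hy hxy =>
        ⟨x + 1, by simp only [Finset.mem_range] at *; omega, by omega, by omega⟩)
    have hB := hmatch (Finset.Ico (a + k) (a + k + b))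
      (by
        rw [Nat.card_Ico, Nat.add_sub_cancel_left]
        obtain ⟨r, hr⟩ := hae
        exact ⟨m - k - r, by omega⟩)
      (fun x hx => by simp only [Finset.mem_Ico] at hx; omega)
      (fun x hx y hy hxy =>
        ⟨x + 1, by simp only [Finset.mem_Ico] at *; omega, by omega, by omega⟩)
    have := hA.union hB (hdisj _ _ (fun x hx => by simp at hx; omega)
      (fun x hx => by simp at hx; omega)
      (Set.disjoint_left.2 fun x hx hx' => by simp at hx hx'; omega))
    rw [← Set.image_union] at this
    simpa using this
  · set p := (a - b) / 2 with hp
    obtain ⟨r, hr⟩ := hao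
    have hpa : p < a := by omega
    have hpb : a + k ≤ p + m ∧ p + m < a + k + b := by omega
    have hA := hmatch ((Finset.range a).erase p)
      (by
        rw [Finset.card_erase_of_mem (by simpa using hpa), Finset.card_range]
        exact ⟨r, by omega⟩)
      (fun x hx => by simp only [Finset.mem_erase, Finset.mem_range] at hx; omega)
      (fun x hx y hy hxy => by
        simp only [Finset.mem_erase, Finset.mem_range] at *
        by_cases h : x + 1 = p
        · exact ⟨x + 2, by omega, by omega, by omega⟩
        · exact ⟨x + 1, by omega, by omega, by omega⟩)
    have hB := hmatch ((Finset.Ico (a + k) (a + k + b)).erase (p + m))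
      (by
        rw [Finset.card_erase_of_mem (by simpa using hpb), Nat.card_Ico]
        exact ⟨m - k - r - 1, by omega⟩)
      (fun x hx => by simp only [Finset.mem_erase, Finset.mem_Ico] at hx; omega)
      (fun x hx y hy hxy => by
        simp only [Finset.mem_erase, Finset.mem_Ico] at *
        by_cases h : x + 1 = p + m
        · exact ⟨x + 2, by omega, by omega, by omega⟩
        · exact ⟨x + 1, by omega, by omega, by omega⟩)
    have hadj : (cyclePower ν k {(m : ZMod ν)}).Adj (f p) (f (p + m)) := by
      refine ⟨fun h => ?_, Or.inr (Or.inr ?_)⟩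
      · have := hf (show p < ν by omega) (show p + m < ν by omega) h
        omega
      · simp [f]
    have hP : HasMatchingOn (cyclePower ν k {(m : ZMod ν)}) (f '' {p, p + m}) := by
      rw [Set.image_pair]
      exact HasMatchingOn.pair hadj
    have hAB := hA.union hB (hdisj _ _ (fun x hx => by simp at hx; omega)
      (fun x hx => by simp at hx; omega)
      (Set.disjoint_left.2 fun x hx hx' => by simp at hx hx'; omega))
    rw [← Set.image_union] at hAB
    have := hAB.union hP (hdisj _ _ (fun x hx => by simp at hx; omega)
      (fun x hx => by simp at hx; omega)
      (Set.disjoint_left.2 fun x hx hx' => by simp at hx hx'; omega))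
    rw [← Set.image_union] at this
    convert this using 2
    ext x
    simp
    omega

end Circulant

section Ladder

/-- The cubic graph on `Fin (2 * m)` obtained from the ladder with rungs `{2 * i - 1, 2 * i}` by
capping each end with a triangle and joining the two caps `0` and `2 * m - 1`. -/
def cappedLadder (m : ℕ) : SimpleGraph (Fin (2 * m)) :=
  SimpleGraph.fromRel fun x y =>
    (y : ℕ) = x + 2 ∨ ((y : ℕ) = x + 1 ∧ ((x : ℕ) % 2 = 1 ∨ (x : ℕ) = 0 ∨ (y : ℕ) + 1 = 2 * m)) ∨
      ((x : ℕ) = 0 ∧ (y : ℕ) + 1 = 2 * m)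

theorem ncard_neighborSet_cappedLadder_le {m : ℕ} (hm : 2 ≤ m) (x : Fin (2 * m)) :
    ((cappedLadder m).neighborSet x).ncard ≤ 3 := by
  classical
  set a : ℕ := if (x : ℕ) + 1 = 2 * m then 2 * m - 2 else min (x + 2) (2 * m - 1) with ha
  set b : ℕ := if (x : ℕ) = 0 then 1 else x - 2 with hb
  set c : ℕ := if (x : ℕ) = 0 then 2 * m - 1 else if (x : ℕ) + 1 = 2 * m then 0 else
    if (x : ℕ) % 2 = 1 then x + 1 else x - 1 with hc
  rw [Set.ncard_eq_toFinset_card']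
  refine (Finset.card_le_card_of_injOn Fin.val (t := {a, b, c}) ?_ Fin.val_injective.injOn).trans
    Finset.card_le_three
  intro y hy
  have hx := x.isLt
  have hy' := y.isLt
  replace hy : (cappedLadder m).Adj x y := by simpa using hy
  simp only [cappedLadder, fromRel_adj, ne_eq, Fin.ext_iff] at hy
  simp only [Finset.coe_insert, Finset.coe_singleton, Set.mem_insert_iff, Set.mem_singleton_iff]
  split_ifs at ha hb hc <;> omega

variable {V : Type*} {G : SimpleGraph V}

theorem HasMatchingOn.image_Iio_two_mul {g : ℕ → V} (r : ℕ) (hg : Set.InjOn g (Set.Iio (2 * r)))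
    (hadj : ∀ l < r, G.Adj (g (2 * l)) (g (2 * l + 1))) :
    HasMatchingOn G (g '' Set.Iio (2 * r)) := by
  induction r with
  | zero => simpa using HasMatchingOn.empty
  | succ r ih =>
    have h := (ih (hg.mono (Set.Iio_subset_Iio (by omega))) fun l hl => hadj l (by omega)).union
      (HasMatchingOn.pair (hadj r (by omega))) (by
        rw [← Set.image_pair]
        refine Set.disjoint_image_image fun x hx y hy hxy => ?_
        simp only [Set.mem_Iio, Set.mem_insert_iff, Set.mem_singleton_iff] at hx hy
        have := hg (show x < _ by omega) (show y < _ by omega) hxy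
        omega)
    rw [← Set.image_pair, ← Set.image_union] at h
    convert h using 2
    ext x
    simp
    omega

/-- In the square of a path on `2 * i + 1` vertices, deleting one of the last two vertices (or the
only one, if `i = 0`) leaves a graph with a perfect matching. -/
theorem HasMatchingOn.image_Iic_two_mul_sdiff {g : ℕ → V} (i u : ℕ) (hui : u ≤ 2 * i)
    (hiu : 2 * i ≤ u + 1) (hg : Set.InjOn g (Set.Iic (2 * i)))
    (h0 : 0 < i → G.Adj (g 0) (g 1)) (hadj : ∀ l, l + 2 ≤ 2 * i → G.Adj (g l) (g (l + 2))) :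
    HasMatchingOn G (g '' (Set.Iic (2 * i) \ {u})) := by
  induction i generalizing u with
  | zero =>
    obtain rfl : u = 0 := by omega
    convert HasMatchingOn.empty (G := G)
    simp
  | succ i ih =>
    obtain ⟨p, q, hpq, hp, hip, hq, hqi, hqu⟩ : ∃ p q : ℕ, G.Adj (g p) (g q) ∧ p ≤ 2 * i ∧
        2 * i ≤ p + 1 ∧ 2 * i < q ∧ q ≤ 2 * (i + 1) ∧ q + u = 4 * i + 3 := by
      by_cases hqz : i = 0 ∧ u = 2
      · obtain ⟨rfl, rfl⟩ := hqz
        exact ⟨0, 1, h0 (by omega), by omega, by omega, by omega, by omega, by omega⟩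
      · refine ⟨4 * i + 1 - u, 4 * i + 3 - u, ?_, by omega, by omega, by omega, by omega, by omega⟩
        have := hadj (4 * i + 1 - u) (by omega)
        rwa [show 4 * i + 1 - u + 2 = 4 * i + 3 - u by omega] at this
    have h := (ih p hp hip (hg.mono (Set.Iic_subset_Iic.2 (by omega))) (fun _ => h0 (by omega))
      fun l hl => hadj l (by omega)).union (HasMatchingOn.pair hpq) (by
        rw [← Set.image_pair]
        refine Set.disjoint_image_image fun x hx y hy hxy => ?_
        simp only [Set.mem_Iic, Set.mem_sdiff, Set.mem_insert_iff, Set.mem_singleton_iff] at hx hy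
        have := hg (show x ≤ _ by omega) (show y ≤ _ by omega) hxy
        omega)
    rw [← Set.image_pair, ← Set.image_union] at h
    convert h using 2
    ext x
    simp only [Set.mem_Iic, Set.mem_sdiff, Set.mem_union, Set.mem_insert_iff,
      Set.mem_singleton_iff]
    omega

theorem isFactorCritical_cappedLadder {m : ℕ} (hm : 2 ≤ m) :
    IsFactorCritical (cappedLadder m) 2 := by
  set g : ℕ → Fin (2 * m) := fun x => ⟨x % (2 * m), Nat.mod_lt _ (by omega)⟩
  have hval : ∀ x, x < 2 * m → (g x : ℕ) = x := fun x hx => Nat.mod_eq_of_lt hx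
  have hinj : ∀ x y, x < 2 * m → y < 2 * m → g x = g y → x = y := fun x y hx hy h => by
    rw [← hval x hx, ← hval y hy, h]
  have hadj : ∀ x y, x < y → y < 2 * m → (y = x + 2 ∨ (y = x + 1 ∧
      (x % 2 = 1 ∨ x = 0 ∨ y + 1 = 2 * m)) ∨ (x = 0 ∧ y + 1 = 2 * m)) →
      (cappedLadder m).Adj (g x) (g y) := fun x y hxy hy h => by
    rw [cappedLadder, fromRel_adj, hval x (by omega), hval y hy]
    exact ⟨fun h => by have := hinj x y (by omega) hy h; omega, Or.inl h⟩
  have hrungs : ∀ i j, i < j → j ≤ m →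
      HasMatchingOn (cappedLadder m) {w | 2 * i + 1 ≤ (w : ℕ) ∧ (w : ℕ) + 2 ≤ 2 * j} := by
    intro i j hij hjm
    convert HasMatchingOn.image_Iio_two_mul (G := cappedLadder m)
      (g := fun x => g (x + 2 * i + 1)) (j - i - 1)
      (fun x hx y hy hxy => by
        simp only [Set.mem_Iio] at hx hy
        have := hinj _ _ (by omega) (by omega) hxy
        omega)
      (fun l hl => hadj _ _ (by omega) (by omega) (by omega)) using 1
    ext w
    simp only [Set.mem_ofPred_eq, Set.mem_image, Set.mem_Iio]
    constructor
    · intro hw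
      exact ⟨w - (2 * i + 1), by omega, Fin.ext (by rw [hval _ (by omega)]; omega)⟩
    · rintro ⟨x, hx, rfl⟩
      rw [hval _ (by omega)]
      omega
  have hlower : ∀ i u, i < m → u ≤ 2 * i → 2 * i ≤ u + 1 →
      HasMatchingOn (cappedLadder m) {w | (w : ℕ) ≤ 2 * i ∧ (w : ℕ) ≠ u} := by
    intro i u him hui hiu
    convert HasMatchingOn.image_Iic_two_mul_sdiff (G := cappedLadder m) (g := g) i u hui hiu
      (fun x hx y hy hxy => by
        simp only [Set.mem_Iic] at hx hy
        exact hinj _ _ (by omega) (by omega) hxy)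
      (fun h => hadj _ _ (by omega) (by omega) (by omega))
      (fun l hl => hadj _ _ (by omega) (by omega) (by omega)) using 1
    ext w
    simp only [Set.mem_ofPred_eq, Set.mem_image, Set.mem_Iic, Set.mem_sdiff, Set.mem_singleton_iff]
    constructor
    · intro hw
      exact ⟨w, hw, Fin.ext (hval _ w.isLt)⟩
    · rintro ⟨x, hx, rfl⟩
      rw [hval _ (by omega)]
      exact hx
  have hupper : ∀ j v, 0 < j → j ≤ m → v < 2 * m → v ≤ 2 * j → 2 * j ≤ v + 1 →
      HasMatchingOn (cappedLadder m) {w | 2 * j ≤ (w : ℕ) + 1 ∧ (w : ℕ) ≠ v} := by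
    intro j v hj hjm hv hvj hjv
    convert HasMatchingOn.image_Iic_two_mul_sdiff (G := cappedLadder m)
      (g := fun x => g (2 * m - 1 - x)) (m - j) (2 * m - 1 - v) (by omega) (by omega)
      (fun x hx y hy hxy => by
        simp only [Set.mem_Iic] at hx hy
        have := hinj _ _ (by omega) (by omega) hxy
        omega)
      (fun h => (hadj _ _ (by omega) (by omega) (by omega)).symm)
      (fun l hl => (hadj _ _ (by omega) (by omega) (by omega)).symm) using 1
    ext w
    simp only [Set.mem_ofPred_eq, Set.mem_image, Set.mem_Iic, Set.mem_sdiff, Set.mem_singleton_iff]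
    have := w.isLt
    constructor
    · intro hw
      exact ⟨2 * m - 1 - w, by omega, Fin.ext (by rw [hval _ (by omega)]; omega)⟩
    · rintro ⟨x, hx, rfl⟩
      rw [hval _ (by omega)]
      omega
  have hlt : ∀ u v : Fin (2 * m), u < v → HasMatchingOn (cappedLadder m) {u, v}ᶜ := by
    intro u v huv
    have hv := v.isLt
    rw [Fin.lt_def] at huv
    rcases (show ((u : ℕ) + 1) / 2 ≤ ((v : ℕ) + 1) / 2 by omega).lt_or_eq with hij | hij
    · convert ((hlower (((u : ℕ) + 1) / 2) u (by omega) (by omega) (by omega)).union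
        (hrungs (((u : ℕ) + 1) / 2) (((v : ℕ) + 1) / 2) hij (by omega)) ?_).union
        (hupper (((v : ℕ) + 1) / 2) v (by omega) (by omega) hv (by omega) (by omega)) ?_ using 1
      · ext w
        simp only [Set.mem_compl_iff, Set.mem_insert_iff, Set.mem_singleton_iff, Fin.ext_iff,
          Set.mem_union, Set.mem_ofPred_eq]
        omega
      · rw [Set.disjoint_left]
        intro w
        simp only [Set.mem_ofPred_eq]
        omega
      · rw [Set.disjoint_left]
        intro w
        simp only [Set.mem_union, Set.mem_ofPred_eq]
        omega
    · have h0 := hadj 0 (2 * m - 1) (by omega) (by omega) (by omega)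
      convert ((hrungs 0 (((u : ℕ) + 1) / 2) (by omega) (by omega)).union
        (hrungs (((u : ℕ) + 1) / 2) m (by omega) (by omega)) ?_).union
        (HasMatchingOn.pair h0) ?_ using 1
      · ext w
        simp only [Set.mem_compl_iff, Set.mem_insert_iff, Set.mem_singleton_iff, Fin.ext_iff,
          Set.mem_union, Set.mem_ofPred_eq, hval 0 (by omega), hval (2 * m - 1) (by omega)]
        omega
      · rw [Set.disjoint_left]
        intro w
        simp only [Set.mem_ofPred_eq]
        omega
      · rw [Set.disjoint_left]
        intro w
        simp only [Set.mem_union, Set.mem_ofPred_eq, Set.mem_insert_iff, Set.mem_singleton_iff,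
          Fin.ext_iff, hval 0 (by omega), hval (2 * m - 1) (by omega)]
        omega
  intro S hS
  obtain ⟨u, v, huv, rfl⟩ := Finset.card_eq_two.1 hS
  change HasMatchingOn _ _
  rw [Finset.coe_pair]
  rcases lt_or_gt_of_ne huv with h | h
  · exact hlt u v h
  · rw [Set.pair_comm]
    exact hlt v u h

end Ladder

theorem exists_isFactorCritical_ncard_neighborSet_le {n ν : ℕ} (hn : 1 ≤ n) (hν : n < ν)
    (hpar : n % 2 = ν % 2) :
    ∃ G : SimpleGraph (Fin ν), IsFactorCritical G n ∧ ∀ v, (G.neighborSet v).ncard ≤ n + 1 := by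
  obtain ⟨t, rfl⟩ : ∃ t, ν = t + 1 := ⟨ν - 1, by omega⟩
  rcases Nat.even_or_odd' n with ⟨k, rfl | rfl⟩
  · obtain ⟨m, hm⟩ : ∃ m, t + 1 = 2 * m := ⟨(t + 1) / 2, by omega⟩
    rcases (show 1 ≤ k by omega).eq_or_lt with rfl | hk
    · rw [hm]
      exact ⟨cappedLadder m, isFactorCritical_cappedLadder (by omega),
        ncard_neighborSet_cappedLadder_le (by omega)⟩
    · have hE : ∀ d ∈ ({(m : ZMod (t + 1))} : Finset (ZMod (t + 1))), -d = d := by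
        intro d hd
        rw [Finset.mem_singleton.1 hd, neg_eq_iff_add_eq_zero, ← Nat.cast_add, ← two_mul, ← hm,
          ZMod.natCast_self]
      have hdeg := ncard_neighborSet_cyclePower_le (k := k) hE
      rw [Finset.card_singleton] at hdeg
      exact ⟨cyclePower (t + 1) k {(m : ZMod (t + 1))},
        isFactorCritical_cyclePower_antipode hm hk, hdeg⟩
  · have hdeg := ncard_neighborSet_cyclePower_le (ν := t + 1) (k := k + 1) (E := ∅) (by simp)
    exact ⟨cyclePower (t + 1) (k + 1) ∅,
      isFactorCritical_cyclePower_empty (by ring) (Nat.even_iff.2 (by omega)), hdeg⟩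

theorem minSize_factorCritical (n ν : ℕ) (hn : 1 ≤ n) (hν : n < ν)
    (hpar : n % 2 = ν % 2) :
    (∀ (V : Type) [Fintype V] (G : SimpleGraph V), Fintype.card V = ν →
      IsFactorCritical G n → ν * (n + 1) / 2 ≤ G.edgeSet.ncard) ∧
    (∃ G : SimpleGraph (Fin ν),
      IsFactorCritical G n ∧ G.edgeSet.ncard = ν * (n + 1) / 2) := by
  refine ⟨fun V _ G hV h => ?_, ?_⟩
  · subst hV
    have := h.card_mul_le hν
    omega
  · obtain ⟨G, hG, hdeg⟩ := exists_isFactorCritical_ncard_neighborSet_le hn hν hpar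
    have hlower := hG.card_mul_le (by simpa using hν)
    have hupper := two_mul_ncard_edgeSet_le hdeg
    rw [Fintype.card_fin] at hlower hupper
    exact ⟨G, hG, by omega⟩
end

section
/- Let r ≥ 1 and s ≥ 2r be integers. Then the bipartite graph H^B_{2r,2s} is (2r−1)-extendable. -/
open SimpleGraph

/-- The bipartite graph `H^B_{2r,2s}` on `ZMod (2*s)`: an even vertex `i` is joined
to an odd vertex `j` iff `j ≡ i + t (mod 2s)` for some odd `t` with `−2r+1 ≤ t ≤ 2r−1`. -/
def hararyBipEven (r s : ℕ) : SimpleGraph (ZMod (2 * s)) :=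
  SimpleGraph.fromRel (fun i j => Even i.val ∧ Odd j.val ∧
    ∃ t : ℤ, Odd t ∧ -(2 * (r : ℤ)) + 1 ≤ t ∧ t ≤ 2 * (r : ℤ) - 1 ∧
      j = i + (t : ZMod (2 * s)))

theorem Finset.addOrderOf_le_card_of_add_mem {A : Type*} [AddGroup A] {g : A} {Y : Finset A}
    (hY : Y.Nonempty) (h : ∀ y ∈ Y, y + g ∈ Y) : addOrderOf g ≤ Y.card := by
  obtain ⟨v, hv⟩ := hY
  have hmem : ∀ n : ℕ, v + n • g ∈ Y := by
    intro n
    induction n with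
    | zero => simpa using hv
    | succ n ih => rw [succ_nsmul, ← add_assoc]; exact h _ ih
  rw [← Finset.card_range (addOrderOf g)]
  refine Finset.card_le_card_of_injOn (fun n => v + n • g) (fun n _ => hmem n) ?_
  intro a ha b hb hab
  exact nsmul_injOn_Iio_addOrderOf (by simpa using ha) (by simpa using hb)
    (add_left_cancel hab)

/-- Adding an arithmetic progression with difference `g` to a nonempty set enlarges it by at least
one element per step, until it reaches the order of `g`. -/
theorem Finset.min_addOrderOf_le_card_add_progression {A : Type*} [AddGroup A] [DecidableEq A]
    (g : A) {X : Finset A} (hX : X.Nonempty) (k : ℕ) :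
    min (addOrderOf g) (X.card + k) ≤
      (Finset.image₂ (fun x (j : ℕ) => x + j • g) X (Finset.range (k + 1))).card := by
  induction k with
  | zero => simp [Finset.image₂_singleton_right]
  | succ k ih =>
    set N := fun k => Finset.image₂ (fun x (j : ℕ) => x + j • g) X (Finset.range (k + 1)) with hN
    change _ ≤ (N (k + 1)).card
    change _ ≤ (N k).card at ih
    have hsub : N k ⊆ N (k + 1) :=
      Finset.image₂_subset_left (Finset.range_subset_range.2 (by lia))
    by_cases hlt : (N k).card < (N (k + 1)).card
    · omega
    have heq : N k = N (k + 1) := Finset.eq_of_subset_of_card_le hsub (not_lt.1 hlt)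
    have : addOrderOf g ≤ (N k).card := by
      refine Finset.addOrderOf_le_card_of_add_mem (hX.image₂ (by simp)) fun y hy => ?_
      rw [heq]
      obtain ⟨x, hx, j, hj, rfl⟩ := Finset.mem_image₂.1 hy
      refine Finset.mem_image₂.2 ⟨x, hx, j + 1, by simpa using hj, ?_⟩
      rw [succ_nsmul, add_assoc]
    rw [← heq]
    omega

/-- If every edge of a matching has exactly one end satisfying `p`, then its edges are counted by
the covered vertices satisfying `p`. -/
theorem SimpleGraph.Subgraph.IsMatching.ncard_verts_inter_eq_ncard_edgeSet {V : Type*}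
    {G : SimpleGraph V} {M : G.Subgraph} (hM : M.IsMatching) (p : V → Prop)
    (hp : ∀ v w, G.Adj v w → (p v ↔ ¬ p w)) :
    {v | v ∈ M.verts ∧ p v}.ncard = M.edgeSet.ncard := by
  choose f hf hfu using fun v (hv : v ∈ M.verts) => hM hv
  refine Set.ncard_congr (fun v hv => s(v, f v hv.1)) ?_ ?_ ?_
  · intro v hv
    exact hf v hv.1
  · intro v w hv hw h
    rcases Sym2.eq_iff.1 h with h | h
    · exact h.1
    · have := hp v (f v hv.1) (M.adj_sub (hf v hv.1))
      rw [h.2] at this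
      exact absurd hw.2 (this.1 hv.2)
  · intro e
    induction e with
    | _ a b =>
      intro h
      have hab : M.Adj a b := h
      by_cases ha : p a
      · exact ⟨a, ⟨M.edge_vert hab, ha⟩, by rw [← hfu a _ b hab]⟩
      · have hb : p b := by
          by_contra hb
          exact ha ((hp a b (M.adj_sub hab)).2 hb)
        refine ⟨b, ⟨M.edge_vert hab.symm, hb⟩, ?_⟩
        rw [← hfu b _ a hab.symm, Sym2.eq_swap]

theorem ZMod.even_val_add_intCast {s : ℕ} (hs : s ≠ 0) (x : ZMod (2 * s)) (t : ℤ) :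
    Even (x + (t : ZMod (2 * s))).val ↔ (Even x.val ↔ Even t) := by
  have : NeZero (2 * s) := ⟨by omega⟩
  have h : (((x + (t : ZMod (2 * s))).val : ℤ) : ZMod (2 * s)) =
      ((x.val + t : ℤ) : ZMod (2 * s)) := by
    simp
  rw [ZMod.intCast_eq_intCast_iff_dvd_sub] at h
  have h2 : (2 : ℤ) ∣ (x.val + t) - ((x + (t : ZMod (2 * s))).val : ℤ) :=
    dvd_trans ⟨(s : ℤ), by push_cast; ring⟩ h
  rw [← even_iff_two_dvd, Int.even_sub, Int.even_add, Int.even_coe_nat, Int.even_coe_nat] at h2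
  exact h2.symm

theorem ZMod.even_val_add_one {s : ℕ} (hs : s ≠ 0) (x : ZMod (2 * s)) :
    Even (x + 1).val ↔ ¬ Even x.val := by
  simpa using ZMod.even_val_add_intCast hs x 1

theorem ZMod.card_filter_even_val {s : ℕ} [NeZero (2 * s)] :
    (Finset.univ.filter fun x : ZMod (2 * s) => Even x.val).card = s ∧
    (Finset.univ.filter fun x : ZMod (2 * s) => ¬ Even x.val).card = s := by
  have hs : s ≠ 0 := by
    rintro rfl
    exact NeZero.ne (2 * 0) rfl
  have hsum := Finset.card_filter_add_card_filter_not (s := (Finset.univ : Finset (ZMod (2 * s))))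
    (fun x => Even x.val)
  have heq : (Finset.univ.filter fun x : ZMod (2 * s) => Even x.val).card =
      (Finset.univ.filter fun x : ZMod (2 * s) => ¬ Even x.val).card := by
    refine Finset.card_equiv (Equiv.addRight 1) fun x => ?_
    simp only [Finset.mem_filter, Finset.mem_univ, true_and, Equiv.coe_addRight,
      ZMod.even_val_add_one hs, not_not]
  rw [Finset.card_univ, ZMod.card] at hsum
  omega

theorem hararyBipEven_adj_parity {r s : ℕ} {v w : ZMod (2 * s)}
    (h : (hararyBipEven r s).Adj v w) : Even v.val ↔ ¬ Even w.val := by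
  rw [hararyBipEven, fromRel_adj] at h
  rcases h.2 with ⟨hv, hw, -⟩ | ⟨hv, hw, -⟩
  · rw [Nat.not_even_iff_odd]
    exact iff_of_true hv hw
  · rw [← Nat.not_even_iff_odd] at hw
    exact iff_of_false hw (not_not.2 hv)

theorem hararyBipEven_adj_add {r s : ℕ} (hs : s ≠ 0) {x : ZMod (2 * s)} (hx : Even x.val)
    {t : ℤ} (ht : Odd t) (h₁ : -(2 * (r : ℤ)) + 1 ≤ t) (h₂ : t ≤ 2 * (r : ℤ) - 1) :
    (hararyBipEven r s).Adj x (x + (t : ZMod (2 * s))) := by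
  have hodd : ¬ Even (x + (t : ZMod (2 * s))).val := by
    rw [ZMod.even_val_add_intCast hs, ← Int.not_odd_iff_even]
    tauto
  rw [hararyBipEven, fromRel_adj]
  refine ⟨fun h => hodd (h ▸ hx), Or.inl ⟨hx, Nat.not_even_iff_odd.1 hodd, t, ht, h₁, h₂, rfl⟩⟩

theorem hararyBipEven_adj_add_one {r s : ℕ} (hr : 1 ≤ r) (hs : s ≠ 0) (x : ZMod (2 * s)) :
    (hararyBipEven r s).Adj x (x + 1) := by
  by_cases hx : Even x.val
  · simpa using hararyBipEven_adj_add (r := r) hs hx (t := 1) odd_one (by omega) (by omega)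
  · have := hararyBipEven_adj_add (r := r) hs ((ZMod.even_val_add_one hs x).2 hx) (t := -1)
      (by decide) (by omega) (by omega)
    simpa using this.symm

theorem hararyBipEven_connected {r s : ℕ} (hr : 1 ≤ r) (hs : s ≠ 0) :
    (hararyBipEven r s).Connected := by
  have : NeZero (2 * s) := ⟨by omega⟩
  have hreach : ∀ n : ℕ, (hararyBipEven r s).Reachable 0 (n : ZMod (2 * s)) := by
    intro n
    induction n with
    | zero => simp
    | succ n ih =>
      push_cast
      exact ih.trans (hararyBipEven_adj_add_one hr hs _).reachable
  have hzero : ∀ x, (hararyBipEven r s).Reachable 0 x := fun x => by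
    simpa using hreach x.val
  exact ⟨fun x y => (hzero x).symm.trans (hzero y)⟩

theorem hararyBipEven_exists_matching {r s k : ℕ} (hr : 1 ≤ r) (hs : s ≠ 0) (hk : k ≤ s) :
    ∃ M : (hararyBipEven r s).Subgraph, M.IsMatching ∧ M.edgeSet.ncard = k := by
  have : NeZero (2 * s) := ⟨by omega⟩
  obtain ⟨S, hS, hcard⟩ := Finset.exists_subset_card_eq
    (hk.trans_eq (ZMod.card_filter_even_val (s := s)).1.symm)
  have hSe : ∀ x ∈ S, Even x.val := fun x hx => (Finset.mem_filter.1 (hS hx)).2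
  have hdisj : Disjoint (S : Set (ZMod (2 * s))) ((· + 1) '' (S : Set (ZMod (2 * s)))) := by
    rw [Set.disjoint_left]
    rintro _ hx ⟨y, hy, rfl⟩
    exact (ZMod.even_val_add_one hs y).1 (hSe _ hx) (hSe y hy)
  obtain ⟨M, hverts, hM⟩ := Subgraph.IsMatching.exists_of_disjoint_sets_of_equiv
    (G := hararyBipEven r s) hdisj
    (Equiv.Set.image (· + 1) (S : Set (ZMod (2 * s))) (add_left_injective 1))
    (fun v => hararyBipEven_adj_add_one hr hs _)
  refine ⟨M, hM, ?_⟩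
  rw [← hM.ncard_verts_inter_eq_ncard_edgeSet _ fun _ _ => hararyBipEven_adj_parity, ← hcard,
    ← Set.ncard_coe_finset]
  congr 1
  ext x
  rw [Set.mem_ofPred_eq, hverts]
  constructor
  · rintro ⟨hx | ⟨y, hy, rfl⟩, he⟩
    · exact hx
    · exact absurd (hSe y hy) ((ZMod.even_val_add_one hs y).1 he)
  · exact fun hx => ⟨Or.inl hx, hSe x hx⟩

theorem hararyBipEven_card_le_card_neighbors {r s : ℕ} (hr : 1 ≤ r) [NeZero (2 * s)]
    {X : Finset (ZMod (2 * s))} (hX : X.Nonempty) (hXe : ∀ x ∈ X, Even x.val) :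
    ∃ N : Finset (ZMod (2 * s)), (∀ y ∈ N, ¬ Even y.val ∧ ∃ x ∈ X, (hararyBipEven r s).Adj x y) ∧
      min s (X.card + (2 * r - 1)) ≤ N.card := by
  have hs : s ≠ 0 := by
    rintro rfl
    exact NeZero.ne (2 * 0) rfl
  have hord : addOrderOf (2 : ZMod (2 * s)) = s := by
    have := ZMod.addOrderOf_coe 2 (NeZero.ne (2 * s))
    rw [Nat.gcd_mul_right_left, Nat.mul_div_cancel_left _ two_pos] at this
    exact_mod_cast this
  set c : ZMod (2 * s) := ((-(2 * (r : ℤ)) + 1 : ℤ) : ZMod (2 * s))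
  have hcard : (X.image (· + c)).card = X.card :=
    Finset.card_image_of_injective _ (add_left_injective c)
  have hmain := Finset.min_addOrderOf_le_card_add_progression (2 : ZMod (2 * s))
    (hX.image (· + c)) (2 * r - 1)
  rw [hord, hcard] at hmain
  refine ⟨_, fun y hy => ?_, hmain⟩
  obtain ⟨z, hz, j, hj, rfl⟩ := Finset.mem_image₂.1 hy
  obtain ⟨x, hx, rfl⟩ := Finset.mem_image.1 hz
  have hj' : j < 2 * r := by
    have := Finset.mem_range.1 hj
    omega
  have hadj : (hararyBipEven r s).Adj x (x + c + j • (2 : ZMod (2 * s))) := by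
    have := hararyBipEven_adj_add (r := r) hs (hXe x hx) (t := -(2 * (r : ℤ)) + 1 + j * 2)
      ⟨-r + j, by ring⟩ (by omega) (by omega)
    rw [Int.cast_add, ← add_assoc] at this
    simpa [c] using this
  exact ⟨(hararyBipEven_adj_parity hadj).1 (hXe x hx), x, hx, hadj⟩

theorem hararyBipEven_matching_extends {r s : ℕ} (hr : 1 ≤ r) (hs : s ≠ 0)
    {M : (hararyBipEven r s).Subgraph} (hM : M.IsMatching) (hMk : M.edgeSet.ncard = 2 * r - 1) :
    ∃ P : (hararyBipEven r s).Subgraph, P.IsPerfectMatching ∧ M ≤ P := by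
  classical
  have : NeZero (2 * s) := ⟨by omega⟩
  obtain ⟨hE, hO⟩ := ZMod.card_filter_even_val (s := s)
  set E := Finset.univ.filter fun x : ZMod (2 * s) => Even x.val with hEdef
  set O := Finset.univ.filter fun x : ZMod (2 * s) => ¬ Even x.val with hOdef
  have hmemE : ∀ x, x ∈ E ↔ Even x.val := by simp [hEdef]
  have hmemO : ∀ x, x ∈ O ↔ ¬ Even x.val := by simp [hOdef]
  have hEM : (E.filter (· ∈ M.verts)).card = 2 * r - 1 := by
    rw [← hMk, ← hM.ncard_verts_inter_eq_ncard_edgeSet (fun x => Even x.val)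
      fun _ _ => hararyBipEven_adj_parity, ← Set.ncard_coe_finset]
    congr 1
    ext x
    simp [hmemE, and_comm]
  have hOM : (O.filter (· ∈ M.verts)).card = 2 * r - 1 := by
    rw [← hMk, ← hM.ncard_verts_inter_eq_ncard_edgeSet (fun x => ¬ Even x.val)
      fun _ _ h => not_congr (hararyBipEven_adj_parity h), ← Set.ncard_coe_finset]
    congr 1
    ext x
    simp [hmemO, and_comm]
  have hEM' := Finset.card_filter_add_card_filter_not (s := E) (· ∈ M.verts)
  have hOM' := Finset.card_filter_add_card_filter_not (s := O) (· ∈ M.verts)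
  set A := E.filter (· ∉ M.verts) with hA
  set B := O.filter (· ∉ M.verts) with hB
  have hall : ∀ S : Finset A, S.card ≤
      (S.biUnion fun x => B.filter ((hararyBipEven r s).Adj x.1)).card := by
    intro S
    rcases S.eq_empty_or_nonempty with rfl | hS
    · simp
    have hXA : S.map (Function.Embedding.subtype _) ⊆ A := by
      intro x hx
      obtain ⟨y, -, rfl⟩ := Finset.mem_map.1 hx
      exact y.2
    obtain ⟨N, hN, hcard⟩ := hararyBipEven_card_le_card_neighbors hr
      (X := S.map (Function.Embedding.subtype _)) (hS.map)
      (fun x hx => (hmemE x).1 (Finset.mem_filter.1 (hXA hx)).1)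
    have hle := Finset.card_le_card hXA
    rw [Finset.card_map] at hcard hle
    have hsub : N \ O.filter (· ∈ M.verts) ⊆
        S.biUnion fun x => B.filter ((hararyBipEven r s).Adj x.1) := by
      intro y hy
      obtain ⟨hyN, hyM⟩ := Finset.mem_sdiff.1 hy
      obtain ⟨hyo, x, hx, hadj⟩ := hN y hyN
      obtain ⟨z, hz, rfl⟩ := Finset.mem_map.1 hx
      have hyO := (hmemO y).2 hyo
      exact Finset.mem_biUnion.2 ⟨z, hz, Finset.mem_filter.2 ⟨Finset.mem_filter.2
        ⟨hyO, fun h => hyM (Finset.mem_filter.2 ⟨hyO, h⟩)⟩, hadj⟩⟩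
    have h₁ := Finset.card_le_card hsub
    have h₂ := Finset.le_card_sdiff (O.filter (· ∈ M.verts)) N
    omega
  obtain ⟨f, hf, hfB⟩ := (Finset.all_card_le_biUnion_card_iff_exists_injective _).1 hall
  have hfmem : ∀ x, f x ∈ B := fun x => (Finset.mem_filter.1 (hfB x)).1
  have hfadj : ∀ x, (hararyBipEven r s).Adj x.1 (f x) := fun x => (Finset.mem_filter.1 (hfB x)).2
  have hbij : Function.Bijective (fun x : A => (⟨f x, hfmem x⟩ : B)) := by
    rw [Fintype.bijective_iff_injective_and_card]
    refine ⟨fun x y h => hf (congrArg Subtype.val h), ?_⟩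
    rw [Fintype.card_coe, Fintype.card_coe]
    omega
  have hdisj : Disjoint (A : Set (ZMod (2 * s))) (B : Set (ZMod (2 * s))) := by
    rw [Set.disjoint_left]
    intro x hx hx'
    exact (hmemO x).1 (Finset.mem_filter.1 hx').1 ((hmemE x).1 (Finset.mem_filter.1 hx).1)
  obtain ⟨M', hverts, hM'⟩ := Subgraph.IsMatching.exists_of_disjoint_sets_of_equiv
    (G := hararyBipEven r s) hdisj (Equiv.ofBijective _ hbij) hfadj
  have hverts' : M'.verts = M.vertsᶜ := by
    ext x
    rw [hverts]
    by_cases hx : Even x.val <;> simp [hA, hB, hmemE, hmemO, hx, -Nat.not_even_iff_odd]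
  refine ⟨M ⊔ M', ⟨hM.sup hM' ?_, ?_⟩, le_sup_left⟩
  · rw [hM.support_eq_verts, hM'.support_eq_verts, hverts']
    exact disjoint_compl_right
  · rw [Subgraph.isSpanning_iff, Subgraph.verts_sup, hverts', Set.union_compl_self]

theorem hararyBipEven_extendable (r s : ℕ) (hr : 1 ≤ r) (hs : 2 * r ≤ s) :
    IsExtendable (hararyBipEven r s) (2 * r - 1) := by
  have hs₀ : s ≠ 0 := by omega
  exact ⟨hararyBipEven_connected hr hs₀, hararyBipEven_exists_matching hr hs₀ (by omega),
    fun _ hM hk => hararyBipEven_matching_extends hr hs₀ hM hk⟩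
end

section
/- Let r ≥ 1 and s ≥ 2r+1 be integers. Then the bipartite graph H^B_{2r+1,2s} is 2r-extendable. -/
open SimpleGraph

/-- The bipartite graph `H^B_{2r+1,2s}` on `ZMod (2*s)`: an even vertex `i` is joined
to an odd vertex `j` iff `j ≡ i + t (mod 2s)` for some odd `t` with `−2r+1 ≤ t ≤ 2r+1`. -/
def hararyBipOdd (r s : ℕ) : SimpleGraph (ZMod (2 * s)) :=
  SimpleGraph.fromRel (fun i j => Even i.val ∧ Odd j.val ∧
    ∃ t : ℤ, Odd t ∧ -(2 * (r : ℤ)) + 1 ≤ t ∧ t ≤ 2 * (r : ℤ) + 1 ∧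
      j = i + (t : ZMod (2 * s)))

namespace SimpleGraph

variable {V : Type*} {G : SimpleGraph V} {A B : Set V}

theorem IsBipartiteWith.ncard_edgeSet_eq [Finite V] (h : G.IsBipartiteWith A B)
    {M : G.Subgraph} (hM : M.IsMatching) : M.edgeSet.ncard = (A ∩ M.verts).ncard := by
  symm
  refine Set.ncard_congr (fun v hv => (hM.toEdge ⟨v, hv.2⟩ : Sym2 V))
    (fun v hv => (hM.toEdge ⟨v, hv.2⟩).2) ?_ ?_
  · intro u v hu hv huv
    obtain ⟨w, hw, -⟩ := hM hu.2
    obtain ⟨x, hx, -⟩ := hM hv.2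
    rw [hM.toEdge_eq_of_adj hw, hM.toEdge_eq_of_adj hx] at huv
    have hAB := Set.disjoint_left.1 h.disjoint
    rcases Sym2.eq_iff.1 huv with ⟨huv, -⟩ | ⟨rfl, rfl⟩
    · exact huv
    · rcases h.mem_of_adj hw.adj_sub with h' | h'
      · exact (hAB hv.1 h'.2).elim
      · exact (hAB hu.1 h'.1).elim
  · intro e he
    induction e with | _ u v
    have huv : M.Adj u v := he
    rcases h.mem_of_adj huv.adj_sub with h' | h'
    · exact ⟨u, ⟨h'.1, huv.fst_mem⟩, by rw [hM.toEdge_eq_of_adj huv]⟩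
    · refine ⟨v, ⟨h'.2, huv.snd_mem⟩, ?_⟩
      exact (congrArg Subtype.val (hM.toEdge_eq_of_adj huv.symm)).trans Sym2.eq_swap

/-- If every nonempty subset of one side of a balanced bipartite graph expands by at least `k`,
or has the whole other side as its neighbourhood, then all matchings of size `k` extend. -/
theorem IsBipartiteWith.exists_isPerfectMatching_ge [Finite V] (h : G.IsBipartiteWith A B)
    (hcover : A ∪ B = Set.univ) (hcard : A.ncard = B.ncard) {k : ℕ}
    (hexp : ∀ X ⊆ A, X.Nonempty →
      min A.ncard (X.ncard + k) ≤ (⋃ x ∈ X, G.neighborSet x).ncard)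
    {M : G.Subgraph} (hM : M.IsMatching) (hk : M.edgeSet.ncard = k) :
    ∃ P : G.Subgraph, P.IsPerfectMatching ∧ M ≤ P := by
  classical
  let G' : SimpleGraph V :=
    { Adj := fun u v => G.Adj u v ∧ u ∉ M.verts ∧ v ∉ M.verts
      symm := ⟨fun _ _ huv => ⟨huv.1.symm, huv.2.2, huv.2.1⟩⟩
      loopless := ⟨fun _ hu => G.irrefl hu.1⟩ }
  have hle : G' ≤ G := fun _ _ huv => huv.1
  have hA : (A ∩ M.verts).ncard = k := by rw [← h.ncard_edgeSet_eq hM, hk]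
  have hB : (B ∩ M.verts).ncard = k := by rw [← h.symm.ncard_edgeSet_eq hM, hk]
  have hbip : G'.IsBipartiteWith (A \ M.verts) (B \ M.verts) :=
    { disjoint := h.disjoint.mono Set.sdiff_subset Set.sdiff_subset
      mem_of_adj := by
        intro u v huv
        have := h.mem_of_adj huv.1
        have := huv.2
        simp only [Set.mem_sdiff]
        tauto }
  have : Fintype V := Fintype.ofFinite V
  have : G'.LocallyFinite := fun v => Fintype.ofFinite _
  obtain ⟨N, hAN, hN⟩ := exists_isMatching_of_forall_ncard_le hbip (by
    intro X hX
    rcases X.eq_empty_or_nonempty with rfl | hne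
    · simp
    have hXA : X ⊆ A := hX.trans Set.sdiff_subset
    have h₁ := hexp X hXA hne
    have h₂ : X.ncard ≤ (A \ M.verts).ncard := Set.ncard_le_ncard hX
    have h₃ := Set.ncard_inter_add_ncard_sdiff_eq_ncard A M.verts
    have h₄ := Set.ncard_inter_add_ncard_sdiff_eq_ncard (⋃ x ∈ X, G.neighborSet x) M.verts
    have h₅ : ((⋃ x ∈ X, G.neighborSet x) ∩ M.verts).ncard ≤ k := by
      rw [← hB]
      refine Set.ncard_le_ncard (Set.inter_subset_inter_left _ ?_)
      exact Set.iUnion₂_subset fun x hx => isBipartiteWith_neighborSet_subset h (hXA hx)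
    have h₆ : (⋃ x ∈ X, G.neighborSet x) \ M.verts ⊆ ⋃ x ∈ X, G'.neighborSet x := by
      rintro v ⟨hv, hvM⟩
      simp only [Set.mem_iUnion] at hv ⊢
      obtain ⟨x, hx, hxv⟩ := hv
      exact ⟨x, hx, hxv, (hX hx).2, hvM⟩
    have h₇ := Set.ncard_le_ncard h₆
    omega)
  have hN' := hN.map_ofLE hle
  have hP : (M ⊔ N.map (Hom.ofLE hle)).IsMatching := by
    refine hM.sup hN' ?_
    rw [hM.support_eq_verts, hN'.support_eq_verts, Set.disjoint_left]
    rintro v hv ⟨w, hw, rfl⟩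
    obtain ⟨x, hx, -⟩ := hN hw
    exact hx.adj_sub.2.1 hv
  refine ⟨_, ⟨hP, ?_⟩, le_sup_left⟩
  set P := M ⊔ N.map (Hom.ofLE hle)
  have hAP : A ⊆ P.verts := by
    intro v hv
    by_cases hvM : v ∈ M.verts
    · exact Or.inl hvM
    · exact Or.inr ⟨v, hAN ⟨hv, hvM⟩, rfl⟩
  have hBP : B ⊆ P.verts := by
    have h₁ := h.ncard_edgeSet_eq hP
    rw [h.symm.ncard_edgeSet_eq hP, Set.inter_eq_left.2 hAP, hcard] at h₁
    exact Set.inter_eq_left.1 (Set.eq_of_subset_of_ncard_le Set.inter_subset_left h₁.ge)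
  rw [Subgraph.isSpanning_iff, ← Set.univ_subset_iff, ← hcover]
  exact Set.union_subset hAP hBP

end SimpleGraph

namespace ZMod

theorem even_val_iff_castHom {s : ℕ} [NeZero s] (x : ZMod (2 * s)) :
    Even x.val ↔ castHom (dvd_mul_right 2 s) (ZMod 2) x = 0 := by
  rw [← natCast_eq_zero_iff_even, natCast_val, castHom_apply]

theorem odd_val_iff_castHom {s : ℕ} [NeZero s] (x : ZMod (2 * s)) :
    Odd x.val ↔ castHom (dvd_mul_right 2 s) (ZMod 2) x = 1 := by
  rw [← natCast_eq_one_iff_odd, natCast_val, castHom_apply]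

theorem even_val_add_one_iff {s : ℕ} [NeZero s] (x : ZMod (2 * s)) :
    Even (x + 1).val ↔ Odd x.val := by
  rw [even_val_iff_castHom, odd_val_iff_castHom, map_add, map_one]
  generalize castHom (dvd_mul_right 2 s) (ZMod 2) x = y
  revert y
  decide

theorem odd_val_add_one_iff {s : ℕ} [NeZero s] (x : ZMod (2 * s)) :
    Odd (x + 1).val ↔ Even x.val := by
  rw [← Nat.not_even_iff_odd, even_val_add_one_iff, Nat.not_odd_iff_even]

theorem odd_val_add_intCast {s : ℕ} [NeZero s] {x : ZMod (2 * s)} (hx : Even x.val)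
    {t : ℤ} (ht : Odd t) : Odd (x + (t : ZMod (2 * s))).val := by
  rw [even_val_iff_castHom] at hx
  rw [odd_val_iff_castHom, map_add, hx, map_intCast, zero_add]
  exact (intCast_eq_one_iff_odd).2 ht

theorem ncard_even_eq_ncard_odd (s : ℕ) [NeZero s] :
    {x : ZMod (2 * s) | Even x.val}.ncard = {x : ZMod (2 * s) | Odd x.val}.ncard := by
  rw [← Set.ncard_image_of_injective _ (add_left_injective (1 : ZMod (2 * s)))]
  congr 1
  ext x
  simp only [Set.mem_image, Set.mem_ofPred_eq]
  constructor
  · rintro ⟨y, hy, rfl⟩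
    exact (odd_val_add_one_iff y).2 hy
  · intro hx
    exact ⟨x - 1, (odd_val_add_one_iff _).1 (by simpa using hx), by simp⟩

theorem ncard_even (s : ℕ) [NeZero s] : {x : ZMod (2 * s) | Even x.val}.ncard = s := by
  have h := Set.ncard_add_ncard_compl {x : ZMod (2 * s) | Even x.val}
  have h' : {x : ZMod (2 * s) | Even x.val}ᶜ = {x : ZMod (2 * s) | Odd x.val} := by
    ext x; simp
  rw [h', ← ncard_even_eq_ncard_odd, Nat.card_zmod] at h
  omega

/-- Adding a progression of difference two to a nonempty set in `ZMod (2 * s)` enlarges it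
by at least the length of the progression, up to the size of a coset of the even residues. -/
theorem min_le_ncard_add_progression {s : ℕ} [NeZero s] {X : Set (ZMod (2 * s))}
    (hX : X.Nonempty) (n : ℕ) :
    min s (X.ncard + n) ≤ {y | ∃ x ∈ X, ∃ i ≤ n, y = x + ((2 * i : ℕ) : ZMod (2 * s))}.ncard := by
  induction n with
  | zero => simp
  | succ n ih =>
    set T := {y | ∃ x ∈ X, ∃ i ≤ n, y = x + ((2 * i : ℕ) : ZMod (2 * s))}
    set T' := {y | ∃ x ∈ X, ∃ i ≤ n + 1, y = x + ((2 * i : ℕ) : ZMod (2 * s))}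
    have hTT' : T ⊆ T' := by
      rintro y ⟨x, hx, i, hi, rfl⟩
      exact ⟨x, hx, i, by omega, rfl⟩
    rcases hTT'.eq_or_ssubset with heq | hss
    · obtain ⟨x, hx⟩ := hX
      have hmem : ∀ i : ℕ, x + ((2 * i : ℕ) : ZMod (2 * s)) ∈ T := by
        intro i
        induction i with
        | zero => exact ⟨x, hx, 0, by omega, rfl⟩
        | succ i ihi =>
          obtain ⟨z, hz, j, hj, hzj⟩ := ihi
          rw [heq]
          refine ⟨z, hz, j + 1, by omega, ?_⟩
          push_cast at hzj ⊢
          linear_combination hzj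
      have hinj : Set.InjOn (fun i : ℕ => x + ((2 * i : ℕ) : ZMod (2 * s))) (Set.Iio s) := by
        intro i hi j hj hij
        have := (natCast_eq_natCast_iff' _ _ _).1 (add_left_cancel hij)
        simp only [Set.mem_Iio] at hi hj
        rw [Nat.mod_eq_of_lt (by omega), Nat.mod_eq_of_lt (by omega)] at this
        omega
      have hle : (Set.image (fun i : ℕ => x + ((2 * i : ℕ) : ZMod (2 * s))) (Set.Iio s)).ncard ≤
          T'.ncard :=
        Set.ncard_le_ncard (heq ▸ Set.image_subset_iff.2 fun i _ => hmem i)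
      rw [hinj.ncard_image, Set.ncard_eq_toFinset_card', Set.toFinset_Iio,
        Nat.card_Iio] at hle
      omega
    · have := Set.ncard_lt_ncard hss
      omega

end ZMod

section hararyBipOdd

variable {r s : ℕ} [NeZero s]

theorem hararyBipOdd_adj_of_even {u v : ZMod (2 * s)} (hu : Even u.val) {t : ℤ} (ht : Odd t)
    (h₁ : -(2 * (r : ℤ)) + 1 ≤ t) (h₂ : t ≤ 2 * (r : ℤ) + 1) (hv : v = u + (t : ZMod (2 * s))) :
    (hararyBipOdd r s).Adj u v := by
  have hodd : Odd v.val := hv ▸ ZMod.odd_val_add_intCast hu ht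
  refine (SimpleGraph.fromRel_adj _ _ _).2 ⟨?_, Or.inl ⟨hu, hodd, t, ht, h₁, h₂, hv⟩⟩
  rintro rfl
  exact Nat.not_even_iff_odd.2 hodd hu

theorem hararyBipOdd_isBipartiteWith (r s : ℕ) :
    (hararyBipOdd r s).IsBipartiteWith {x | Even x.val} {x | Odd x.val} where
  disjoint := Set.disjoint_left.2 fun _ hx => Nat.not_odd_iff_even.2 hx
  mem_of_adj := by
    intro u v huv
    rcases ((SimpleGraph.fromRel_adj _ _ _).1 huv).2 with h | h
    · exact Or.inl ⟨h.1, h.2.1⟩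
    · exact Or.inr ⟨h.2.1, h.1⟩

theorem hararyBipOdd_adj_add_one (hr : 1 ≤ r) (u : ZMod (2 * s)) :
    (hararyBipOdd r s).Adj u (u + 1) := by
  rcases Nat.even_or_odd u.val with hu | hu
  · exact hararyBipOdd_adj_of_even hu odd_one (by omega) (by omega) (by simp)
  · exact (hararyBipOdd_adj_of_even ((ZMod.even_val_add_one_iff u).2 hu) (t := -1) (by decide)
      (by omega) (by omega) (by simp)).symm

theorem hararyBipOdd_connected (hr : 1 ≤ r) : (hararyBipOdd r s).Connected := by
  have h : ∀ n : ℕ, (hararyBipOdd r s).Reachable 0 (n : ZMod (2 * s)) := by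
    intro n
    induction n with
    | zero => simp
    | succ n ih =>
      rw [Nat.cast_succ]
      exact ih.trans (hararyBipOdd_adj_add_one hr _).reachable
  refine (SimpleGraph.connected_iff_exists_forall_reachable _).2 ⟨0, fun v => ?_⟩
  simpa using h v.val

theorem hararyBipOdd_expansion {X : Set (ZMod (2 * s))} (hX : X ⊆ {x | Even x.val})
    (hne : X.Nonempty) :
    min s (X.ncard + 2 * r) ≤ (⋃ x ∈ X, (hararyBipOdd r s).neighborSet x).ncard := by
  refine (ZMod.min_le_ncard_add_progression hne (2 * r)).trans ?_
  rw [← Set.ncard_image_of_injective _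
    (add_left_injective ((-(2 * (r : ℤ)) + 1 : ℤ) : ZMod (2 * s)))]
  refine Set.ncard_le_ncard ?_
  rintro _ ⟨_, ⟨x, hx, i, hi, rfl⟩, rfl⟩
  refine Set.mem_biUnion hx (hararyBipOdd_adj_of_even (hX hx)
    (t := 2 * (i : ℤ) + (-(2 * (r : ℤ)) + 1)) ⟨i - r, by ring⟩ (by omega) (by omega) ?_)
  push_cast
  ring

theorem hararyBipOdd_exists_isPerfectMatching_ge {M : (hararyBipOdd r s).Subgraph}
    (hM : M.IsMatching) {k : ℕ} (hk : M.edgeSet.ncard = k) (hkr : k ≤ 2 * r) :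
    ∃ P : (hararyBipOdd r s).Subgraph, P.IsPerfectMatching ∧ M ≤ P := by
  refine (hararyBipOdd_isBipartiteWith r s).exists_isPerfectMatching_ge
    (Set.eq_univ_of_forall fun x => Nat.even_or_odd x.val) (ZMod.ncard_even_eq_ncard_odd s)
    (fun X hX hne => ?_) hM hk
  have := hararyBipOdd_expansion (r := r) hX hne
  rw [ZMod.ncard_even]
  omega

end hararyBipOdd

/-- Every matching with at least `k` edges contains a matching with exactly `k` edges. -/
theorem SimpleGraph.Subgraph.IsMatching.exists_ncard_edgeSet_eq {V : Type*} [Finite V]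
    {G : SimpleGraph V} {P : G.Subgraph} (hP : P.IsMatching) {k : ℕ}
    (hk : k ≤ P.edgeSet.ncard) : ∃ M : G.Subgraph, M.IsMatching ∧ M.edgeSet.ncard = k := by
  obtain ⟨E, hE, hEk⟩ := Set.exists_subset_card_eq hk
  let M : G.Subgraph :=
    { verts := {v | ∃ w, s(v, w) ∈ E}
      Adj := fun u v => s(u, v) ∈ E
      adj_sub := fun huv => P.adj_sub (hE huv)
      edge_vert := fun huv => ⟨_, huv⟩
      symm := ⟨fun u v huv => by rwa [Sym2.eq_swap]⟩ }
  refine ⟨M, ?_, ?_⟩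
  · rintro v ⟨w, hw⟩
    exact ⟨w, hw, fun x hx => hP.eq_of_adj_left (hE hx) (hE hw)⟩
  · have : M.edgeSet = E := by
      ext e
      induction e with | _ u v
      rfl
    rw [this, hEk]

theorem hararyBipOdd_extendable (r s : ℕ) (hr : 1 ≤ r) (hs : 2 * r + 1 ≤ s) :
    IsExtendable (hararyBipOdd r s) (2 * r) := by
  have : NeZero s := ⟨by omega⟩
  refine ⟨hararyBipOdd_connected hr, ?_, fun M hM hk =>
    hararyBipOdd_exists_isPerfectMatching_ge hM hk le_rfl⟩
  obtain ⟨P, hP, -⟩ := hararyBipOdd_exists_isPerfectMatching_ge (r := r) (s := s)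
    (M := ⊥) (fun v hv => hv.elim) (k := 0) (by simp) (by omega)
  refine hP.1.exists_ncard_edgeSet_eq ?_
  rw [(hararyBipOdd_isBipartiteWith r s).ncard_edgeSet_eq hP.1, hP.2.verts_eq_univ,
    Set.inter_univ, ZMod.ncard_even]
  omega
end

section
/- Let k ≥ 1 be an integer and ν ≥ 2k+2 an even integer. Then every k-extendable bipartite finite simple graph on ν vertices has at least ν(k+1)/2 edges, and there exists a k-extendable bipartite finite simple graph on ν vertices with exactly ν(k+1)/2 edges. Hence the minimum size of a k-extendable bipartite graph on ν vertices is exactly ν(k+1)/2. -/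
open SimpleGraph

/-- A fixed-point-free involution along edges of `G`, that is, a perfect matching of `G`
presented as the function sending each vertex to its partner. -/
def SimpleGraph.IsPairing {V : Type*} (G : SimpleGraph V) (p : V → V) : Prop :=
  (∀ v, G.Adj v (p v)) ∧ Function.Involutive p

/-- The subgraph consisting of the edges joining `x ∈ T` to `f x`. -/
def SimpleGraph.subgraphOfFun {V : Type*} (G : SimpleGraph V) (T : Set V) (f : V → V)
    (h : ∀ x ∈ T, G.Adj x (f x)) : G.Subgraph where
  verts := T ∪ f '' T
  Adj u v := (u ∈ T ∧ f u = v) ∨ (v ∈ T ∧ f v = u)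
  adj_sub := by
    rintro u v (⟨hu, rfl⟩ | ⟨hv, rfl⟩)
    exacts [h u hu, (h v hv).symm]
  edge_vert := by
    rintro u v (⟨hu, rfl⟩ | ⟨hv, rfl⟩)
    exacts [Or.inl hu, Or.inr ⟨v, hv, rfl⟩]
  symm := ⟨fun _ _ h => h.symm⟩

section Matchings

variable {V : Type*} {G : SimpleGraph V}

theorem SimpleGraph.edgeSet_subgraphOfFun (T : Set V) (f : V → V)
    (h : ∀ x ∈ T, G.Adj x (f x)) :
    (G.subgraphOfFun T f h).edgeSet = (fun x => s(x, f x)) '' T := by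
  ext e
  induction e with
  | _ u v =>
    simp only [Subgraph.mem_edgeSet, subgraphOfFun, Set.mem_image, Sym2.eq_iff]
    grind

/-- A matching of a two-coloured graph, given by an injection on a set of vertices of one
colour, has as many edges as that set has elements. -/
theorem SimpleGraph.ncard_edgeSet_subgraphOfFun (c : G.Coloring Bool) {β : Bool} {T : Set V}
    {f : V → V} (h : ∀ x ∈ T, G.Adj x (f x)) (hc : ∀ x ∈ T, c x = β) :
    (G.subgraphOfFun T f h).edgeSet.ncard = T.ncard := by
  rw [edgeSet_subgraphOfFun]
  refine Set.InjOn.ncard_image fun x hx y hy hxy => ?_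
  have := c.valid (h y hy)
  simp only [Sym2.eq_iff] at hxy
  grind

theorem SimpleGraph.isMatching_subgraphOfFun (c : G.Coloring Bool) {β : Bool} {T : Set V}
    {f : V → V} (h : ∀ x ∈ T, G.Adj x (f x)) (hc : ∀ x ∈ T, c x = β) (hf : Set.InjOn f T) :
    (G.subgraphOfFun T f h).IsMatching := by
  have hcf : ∀ x ∈ T, c (f x) ≠ β := fun x hx => hc x hx ▸ (c.valid (h x hx)).symm
  rintro v (hv | ⟨x, hx, rfl⟩)
  · refine ⟨f v, Or.inl ⟨hv, rfl⟩, ?_⟩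
    rintro w (⟨-, rfl⟩ | ⟨hw, rfl⟩)
    · rfl
    · exact absurd (hc _ hv) (hcf w hw)
  · refine ⟨x, Or.inr ⟨hx, rfl⟩, ?_⟩
    rintro w (⟨hx', -⟩ | ⟨hw, hwx⟩)
    · exact absurd (hc _ hx') (hcf x hx)
    · exact hf hw hx hwx

theorem SimpleGraph.Subgraph.IsPerfectMatching.exists_isPairing {P : G.Subgraph}
    (hP : P.IsPerfectMatching) : ∃ p : V → V, G.IsPairing p ∧ ∀ u v, P.Adj u v → p u = v := by
  choose p hp hu using Subgraph.isPerfectMatching_iff.1 hP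
  exact ⟨p, ⟨fun v => (hp v).adj_sub, fun v => (hu _ _ (hp v).symm).symm⟩,
    fun u v h => (hu u v h).symm⟩

theorem SimpleGraph.IsPairing.isPerfectMatching {p : V → V} (hp : G.IsPairing p) :
    (G.subgraphOfFun Set.univ p fun x _ => hp.1 x).IsPerfectMatching := by
  rw [Subgraph.isPerfectMatching_iff]
  refine fun v => ⟨p v, Or.inl ⟨trivial, rfl⟩, ?_⟩
  rintro w (⟨-, h⟩ | ⟨-, rfl⟩)
  · exact h.symm
  · exact (hp.2 w).symm

/-- In a `k`-extendable bipartite graph, a matching with `k` edges given by an injection on a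
colour class extends to a pairing. -/
theorem IsExtendable.exists_isPairing_extending {k : ℕ} (hG : IsExtendable G k)
    (c : G.Coloring Bool) {β : Bool} {T : Finset V} {f : V → V} (h : ∀ x ∈ T, G.Adj x (f x))
    (hc : ∀ x ∈ T, c x = β) (hf : Set.InjOn f T) (hT : T.card = k) :
    ∃ p, G.IsPairing p ∧ ∀ x ∈ T, p x = f x := by
  have hc' : ∀ x ∈ (T : Set V), c x = β := hc
  obtain ⟨P, hP, hMP⟩ := hG.2.2 (G.subgraphOfFun T f h) (isMatching_subgraphOfFun c h hc' hf)
    (by rw [ncard_edgeSet_subgraphOfFun c h hc', Set.ncard_coe_finset, hT])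
  obtain ⟨p, hp, hpP⟩ := hP.exists_isPairing
  exact ⟨p, hp, fun x hx => hpP _ _ (hMP.2 (Or.inl ⟨hx, rfl⟩))⟩

theorem IsExtendable.exists_isPairing {k : ℕ} (hG : IsExtendable G k) :
    ∃ p, G.IsPairing p := by
  obtain ⟨M, hM, hMk⟩ := hG.2.1
  obtain ⟨P, hP, -⟩ := hG.2.2 M hM hMk
  obtain ⟨p, hp, -⟩ := hP.exists_isPairing
  exact ⟨p, hp⟩

/-- A criterion for `k`-extendability of a bipartite graph in terms of injections defined on a
colour class. -/
theorem isExtendable_of_exists_isPairing [Finite V] {k : ℕ} (hG : G.Connected)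
    (c : G.Coloring Bool) (β : Bool)
    (hk : ∃ (T : Finset V) (f : V → V), (∀ x ∈ T, c x = β ∧ G.Adj x (f x)) ∧
      Set.InjOn f T ∧ T.card = k)
    (hext : ∀ (T : Finset V) (f : V → V), (∀ x ∈ T, c x = β ∧ G.Adj x (f x)) →
      Set.InjOn f T → T.card = k → ∃ p, G.IsPairing p ∧ ∀ x ∈ T, p x = f x) :
    IsExtendable G k := by
  classical
  refine ⟨hG, ?_, fun M hM hMk => ?_⟩
  · obtain ⟨T, f, h, hf, hT⟩ := hk
    have hc : ∀ x ∈ (T : Set V), c x = β := fun x hx => (h x hx).1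
    refine ⟨G.subgraphOfFun T f fun x hx => (h x hx).2,
      isMatching_subgraphOfFun c _ hc hf, ?_⟩
    rw [ncard_edgeSet_subgraphOfFun c _ hc, Set.ncard_coe_finset, hT]
  · have : ∀ v, ∃ w, v ∈ M.verts → M.Adj v w := fun v => by
      by_cases hv : v ∈ M.verts
      · exact ⟨_, fun _ => (hM hv).exists.choose_spec⟩
      · exact ⟨v, fun h => absurd h hv⟩
    choose f hf using this
    have hfu : ∀ u v, M.Adj u v → f u = v := fun u v huv =>
      (hM huv.fst_mem).unique (hf u huv.fst_mem) huv
    set T : Finset V := (Set.toFinite {v | v ∈ M.verts ∧ c v = β}).toFinset with hTdef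
    have hmT : ∀ x, x ∈ T ↔ x ∈ M.verts ∧ c x = β := fun x => by simp [hTdef]
    have hadj : ∀ x ∈ (T : Set V), G.Adj x (f x) := fun x hx => (hf x ((hmT x).1 hx).1).adj_sub
    have hor : ∀ u v, M.Adj u v → u ∈ T ∨ v ∈ T := fun u v huv => by
      have h1 := c.valid huv.adj_sub
      have h2 := huv.fst_mem
      have h3 := huv.snd_mem
      rw [hmT, hmT]
      cases hu : c u <;> cases hv : c v <;> cases β <;> simp_all
    have hedge : M.edgeSet = (G.subgraphOfFun T f hadj).edgeSet := by
      ext e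
      induction e with
      | _ u v =>
        simp only [Subgraph.mem_edgeSet, subgraphOfFun, Finset.mem_coe]
        constructor
        · intro huv
          rcases hor u v huv with h | h
          · exact Or.inl ⟨h, hfu u v huv⟩
          · exact Or.inr ⟨h, hfu v u huv.symm⟩
        · rintro (⟨h, rfl⟩ | ⟨h, rfl⟩)
          · exact hf u ((hmT u).1 h).1
          · exact (hf v ((hmT v).1 h).1).symm
    have hcard : T.card = k := by
      rw [← hMk, hedge, ncard_edgeSet_subgraphOfFun c hadj fun x hx => ((hmT x).1 hx).2,
        Set.ncard_coe_finset]
    have hinj : Set.InjOn f T := fun x hx y hy hxy => by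
      have h1 := (hf x ((hmT x).1 hx).1).symm
      have h2 := (hf y ((hmT y).1 hy).1).symm
      rw [← hxy] at h2
      exact (hM h1.fst_mem).unique h1 h2
    obtain ⟨p, hp, hpT⟩ := hext T f (fun x hx => ⟨((hmT x).1 hx).2, hadj x hx⟩) hinj hcard
    refine ⟨_, hp.isPerfectMatching, fun v _ => Or.inl trivial, fun u v huv => ?_⟩
    rcases hor u v huv with h | h
    · exact Or.inl ⟨trivial, (hpT u h).trans (hfu u v huv)⟩
    · exact Or.inr ⟨trivial, (hpT v h).trans (hfu v u huv.symm)⟩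

theorem SimpleGraph.Iso.ncard_edgeSet_map {W : Type*} {H : SimpleGraph W} (e : G ≃g H)
    (M : G.Subgraph) : (M.map e.toHom).edgeSet.ncard = M.edgeSet.ncard := by
  rw [Subgraph.edgeSet_map]
  exact Set.ncard_image_of_injective _ (Sym2.map.injective e.injective)

theorem IsExtendable.of_iso {W : Type*} {H : SimpleGraph W} {k : ℕ} (hG : IsExtendable G k)
    (e : G ≃g H) : IsExtendable H k := by
  refine ⟨e.connected_iff.1 hG.1, ?_, fun M hM hMk => ?_⟩
  · obtain ⟨M, hM, hMk⟩ := hG.2.1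
    exact ⟨M.map e.toHom, hM.map _ e.injective, (e.ncard_edgeSet_map M).trans hMk⟩
  · obtain ⟨P, hP, hMP⟩ := hG.2.2 (M.map e.symm.toHom) (hM.map _ e.symm.injective)
      ((e.symm.ncard_edgeSet_map M).trans hMk)
    refine ⟨P.map e.toHom, ⟨hP.1.map _ e.injective, fun v => ?_⟩, ?_⟩
    · exact ⟨e.symm v, hP.2 _, e.apply_symm_apply v⟩
    · have hid : e.toHom.comp e.symm.toHom = Hom.id := RelHom.ext fun x => e.apply_symm_apply x
      calc M = (M.map e.symm.toHom).map e.toHom := by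
            rw [← Subgraph.map_comp, hid, Subgraph.map_id]
        _ ≤ P.map e.toHom := Subgraph.map_mono hMP

end Matchings

section MinDegree

variable {V : Type*} [Fintype V] {G : SimpleGraph V} {k : ℕ}

theorem SimpleGraph.IsPairing.two_mul_card_filter {p : V → V} (hp : G.IsPairing p)
    (c : G.Coloring Bool) (β : Bool) :
    2 * (Finset.univ.filter fun x => c x = β).card = Fintype.card V := by
  classical
  have hne : ∀ x, c (p x) ≠ c x := fun x => (c.valid (hp.1 x)).symm
  have h1 : (Finset.univ.filter fun x => c x = β).card =
      (Finset.univ.filter fun x => ¬ c x = β).card := by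
    refine Finset.card_bij' (fun x _ => p x) (fun x _ => p x) ?_ ?_
      (fun x _ => hp.2 x) (fun x _ => hp.2 x)
    all_goals
      intro x hx
      have := hne x
      cases h : c x <;> cases h' : c (p x) <;> cases β <;> simp_all
  have h2 := Finset.card_filter_add_card_filter_not (s := Finset.univ) fun x => c x = β
  rw [Finset.card_univ] at h2
  omega

/-- In an extendable bipartite graph every edge belongs to a perfect matching. -/
theorem IsExtendable.exists_isPairing_of_adj (hG : IsExtendable G k) (hk : 1 ≤ k)
    (hV : 2 * k + 2 ≤ Fintype.card V) (c : G.Coloring Bool) {x a : V} (hxa : G.Adj x a) :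
    ∃ p, G.IsPairing p ∧ p x = a := by
  classical
  obtain ⟨q, hq⟩ := hG.exists_isPairing
  by_cases hqx : q x = a
  · exact ⟨q, hq, hqx⟩
  have hB := hq.two_mul_card_filter c (c x)
  have hca : c (q a) = c x := by
    have h1 := c.valid hxa
    have h2 := c.valid (hq.1 a)
    cases h : c x <;> cases h' : c a <;> cases h'' : c (q a) <;> simp_all
  have hqa : q a ≠ x := fun h => hqx (by rw [← h, hq.2])
  obtain ⟨T, hxT, hTB, hT⟩ := Finset.exists_subsuperset_card_eq (s := {x})
    (t := (Finset.univ.filter fun y => c y = c x).erase (q a)) (n := k)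
    (by simp [hqa.symm]) (by simpa using hk)
    (by rw [Finset.card_erase_of_mem (by simp [hca])]; omega)
  have hxT : x ∈ T := by simpa using hxT
  have hmem : ∀ y ∈ T, y ≠ q a ∧ c y = c x := fun y hy => by simpa using hTB hy
  obtain ⟨p, hp, hpT⟩ := hG.exists_isPairing_extending c (T := T)
    (f := fun y => if y = x then a else q y) (β := c x)
    (fun y _ => by
      split_ifs with h
      · exact h ▸ hxa
      · exact hq.1 y)
    (fun y hy => (hmem y hy).2)
    (fun y hy z hz hyz => by
      have hy' := (hmem y hy).1
      have hz' := (hmem z hz).1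
      have h1 := hq.2 y
      have h2 := hq.2 z
      dsimp only at hyz
      split_ifs at hyz <;> grind)
    hT
  exact ⟨p, hp, by simpa using hpT x hxT⟩

/-- Positive surplus of proper subsets of a colour class in an extendable bipartite graph. -/
theorem IsExtendable.card_lt_card_neighbors (hG : IsExtendable G k) (hk : 1 ≤ k)
    (hV : 2 * k + 2 ≤ Fintype.card V) (c : G.Coloring Bool) {S N : Finset V} {β : Bool}
    (hS : S.Nonempty) (hSβ : ∀ x ∈ S, c x = β) (hSne : ∃ b, c b = β ∧ b ∉ S)
    (hN : ∀ a, a ∈ N ↔ ∃ x ∈ S, G.Adj x a) : S.card < N.card := by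
  classical
  by_contra! hle
  have himage : ∀ p, G.IsPairing p → S.image p = N := fun p hp => by
    refine Finset.eq_of_subset_of_card_le ?_ ?_
    · intro a ha
      obtain ⟨x, hx, rfl⟩ := Finset.mem_image.1 ha
      exact (hN _).2 ⟨x, hx, hp.1 x⟩
    · rwa [Finset.card_image_of_injective _ hp.2.injective]
  have hclosed : ∀ u w, G.Adj u w → u ∈ S ∪ N → w ∈ S ∪ N := by
    intro u w huw hu
    rcases Finset.mem_union.1 hu with hu | hu
    · exact Finset.mem_union_right _ ((hN w).2 ⟨u, hu, huw⟩)
    · obtain ⟨p, hp, hpw⟩ := hG.exists_isPairing_of_adj hk hV c huw.symm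
      rw [← himage p hp] at hu
      obtain ⟨y, hy, hyu⟩ := Finset.mem_image.1 hu
      rw [← hp.2.injective (hyu.trans hpw.symm)]
      exact Finset.mem_union_left _ hy
  obtain ⟨s, hs⟩ := hS
  obtain ⟨b, hb, hbS⟩ := hSne
  obtain ⟨walk⟩ := hG.1.preconnected s b
  have hall : ∀ {u w : V}, G.Walk u w → u ∈ S ∪ N → w ∈ S ∪ N := by
    intro u w walk
    induction walk with
    | nil => exact id
    | cons h _ ih => exact fun hu => ih (hclosed _ _ h hu)
  rcases Finset.mem_union.1 (hall walk (Finset.mem_union_left _ hs)) with h | h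
  · exact hbS h
  · obtain ⟨x, hx, hxb⟩ := (hN b).1 h
    exact c.valid hxb ((hSβ x hx).trans hb.symm)

theorem IsExtendable.lt_degree [DecidableRel G.Adj] (hG : IsExtendable G k) (hk : 1 ≤ k)
    (hV : 2 * k + 2 ≤ Fintype.card V) (c : G.Coloring Bool) (v : V) : k < G.degree v := by
  classical
  by_contra! hle
  obtain ⟨q, hq⟩ := hG.exists_isPairing
  set B := Finset.univ.filter fun x => c x = !(c v) with hBdef
  have hB : 2 * B.card = Fintype.card V := hq.two_mul_card_filter c _
  have hNB : G.neighborFinset v ⊆ B := fun w hw => by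
    have := c.valid ((G.mem_neighborFinset v w).1 hw)
    cases h : c v <;> cases h' : c w <;> simp_all
  rw [← card_neighborFinset_eq_degree] at hle
  obtain ⟨b, hbB, hbN⟩ := Finset.exists_mem_notMem_of_card_lt_card
    (s := G.neighborFinset v) (t := B) (by omega)
  obtain ⟨h, hinj, hh⟩ := (Finset.all_card_le_biUnion_card_iff_exists_injective
    fun x : B.erase b => (G.neighborFinset x.1).erase v).1 (fun s => by
      rcases s.eq_empty_or_nonempty with rfl | hs
      · simp
      have hlt := hG.card_lt_card_neighbors hk hV c (β := !(c v))
        (S := s.map (Function.Embedding.subtype _))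
        (N := Finset.univ.filter fun a => ∃ x ∈ s.map (Function.Embedding.subtype _), G.Adj x a)
        (by simpa using hs)
        (fun x hx => by
          obtain ⟨y, -, rfl⟩ := Finset.mem_map.1 hx
          simpa [hBdef] using (Finset.mem_erase.1 y.2).2)
        ⟨b, by simpa [hBdef] using hbB, by simp⟩ (by simp)
      rw [Finset.card_map] at hlt
      refine Nat.le_of_lt_succ (hlt.trans_le ?_)
      refine (Finset.card_le_card ?_).trans (Finset.card_insert_le v _)
      intro a ha
      obtain ⟨x, hx, hxa⟩ := (Finset.mem_filter.1 ha).2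
      obtain ⟨y, hy, rfl⟩ := Finset.mem_map.1 hx
      rw [Finset.mem_insert, or_iff_not_imp_left]
      exact fun hav => Finset.mem_biUnion.2 ⟨y, hy, by simpa [hav] using hxa⟩)
  obtain ⟨T, hNT, hTB, hT⟩ := Finset.exists_subsuperset_card_eq
    (s := G.neighborFinset v) (t := B.erase b) (n := k)
    (fun w hw => Finset.mem_erase.2 ⟨fun h => hbN (h ▸ hw), hNB hw⟩) hle
    (by rw [Finset.card_erase_of_mem hbB]; omega)
  have hh' : ∀ x, h x ≠ v ∧ G.Adj x.1 (h x) := fun x => by simpa using hh x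
  set f : V → V := fun x => if hx : x ∈ B.erase b then h ⟨x, hx⟩ else x
  have hf : ∀ x (hx : x ∈ T), f x = h ⟨x, hTB hx⟩ := fun x hx => dif_pos (hTB hx)
  obtain ⟨p, hp, hpT⟩ := hG.exists_isPairing_extending c (T := T) (f := f) (β := !(c v))
    (fun x hx => (hf x hx).symm ▸ (hh' ⟨x, hTB hx⟩).2)
    (fun x hx => by simpa [hBdef] using (Finset.mem_erase.1 (hTB hx)).2)
    (fun x hx y hy hxy => by
      rw [hf x hx, hf y hy] at hxy
      simpa using hinj hxy)
    hT
  have hpv : p v ∈ T := hNT ((G.mem_neighborFinset _ _).2 (hp.1 v))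
  have := hpT _ hpv
  rw [hp.2, hf _ hpv] at this
  exact (hh' _).1 this.symm

end MinDegree

section Circulant

open Finset

/-- The image of `{0, …, k}` in `ZMod n`. -/
def initialResidues (n k : ℕ) : Finset (ZMod n) := (range (k + 1)).image Nat.cast

/-- The bipartite circulant graph in which `x` on the left is joined to `x, x + 1, …, x + k` on
the right. -/
def circulantBipartite (n k : ℕ) : SimpleGraph (ZMod n ⊕ ZMod n) where
  Adj
    | .inl x, .inr y => y - x ∈ initialResidues n k
    | .inr y, .inl x => y - x ∈ initialResidues n k
    | .inl _, .inl _ => False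
    | .inr _, .inr _ => False
  symm := ⟨by rintro (x | x) (y | y) h <;> exact h⟩
  loopless := ⟨by rintro (x | x) h <;> exact h⟩

@[simp]
theorem circulantBipartite_adj_inl_inr {n k : ℕ} {x y : ZMod n} :
    (circulantBipartite n k).Adj (.inl x) (.inr y) ↔ y - x ∈ initialResidues n k := Iff.rfl

@[simp]
theorem circulantBipartite_adj_inr_inl {n k : ℕ} {x y : ZMod n} :
    (circulantBipartite n k).Adj (.inr y) (.inl x) ↔ y - x ∈ initialResidues n k := Iff.rfl

@[simp]
theorem circulantBipartite_not_adj_inl_inl {n k : ℕ} {x y : ZMod n} :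
    ¬ (circulantBipartite n k).Adj (.inl x) (.inl y) := id

@[simp]
theorem circulantBipartite_not_adj_inr_inr {n k : ℕ} {x y : ZMod n} :
    ¬ (circulantBipartite n k).Adj (.inr x) (.inr y) := id

theorem card_initialResidues {n k : ℕ} (h : k + 1 ≤ n) :
    (initialResidues n k).card = k + 1 := by
  rw [initialResidues, card_image_of_injOn, card_range]
  intro a ha b hb hab
  simp only [coe_range, Set.mem_Iio] at ha hb
  have := (ZMod.natCast_eq_natCast_iff' a b n).1 hab
  rwa [Nat.mod_eq_of_lt (by omega), Nat.mod_eq_of_lt (by omega)] at this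

theorem ZMod.eq_univ_of_forall_add_one_mem {n : ℕ} [NeZero n] {U : Finset (ZMod n)}
    (hU : U.Nonempty) (h : ∀ x ∈ U, x + 1 ∈ U) : U = univ := by
  obtain ⟨x, hx⟩ := hU
  have hm : ∀ m : ℕ, x + m ∈ U := fun m => by
    induction m with
    | zero => simpa using hx
    | succ m ih => simpa [add_assoc] using h _ ih
  refine eq_univ_iff_forall.2 fun y => ?_
  simpa using hm (y - x).val

/-- A nonempty set of residues together with its first `k` translates has at least
`min n (|S| + k)` elements. -/
theorem min_le_card_of_forall_add_mem {n : ℕ} [NeZero n] {S : Finset (ZMod n)}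
    (hS : S.Nonempty) (k : ℕ) :
    min n (S.card + k) ≤ (univ.filter fun y => ∃ x ∈ S, y - x ∈ initialResidues n k).card := by
  set U : ℕ → Finset (ZMod n) :=
    fun k => univ.filter fun y => ∃ x ∈ S, y - x ∈ initialResidues n k with hUdef
  have hmem : ∀ k y, y ∈ U k ↔ ∃ x ∈ S, ∃ j : ℕ, j < k + 1 ∧ (j : ZMod n) = y - x := by
    simp [hUdef, initialResidues]
  have hSU : ∀ k, S ⊆ U k := fun k x hx => (hmem k x).2 ⟨x, hx, 0, by omega, by simp⟩
  change min n (S.card + k) ≤ (U k).card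
  induction k with
  | zero => exact (min_le_right _ _).trans (card_le_card (hSU 0))
  | succ k ih =>
    have hsub : U k ⊆ U (k + 1) := fun y hy => by
      obtain ⟨x, hx, j, hj, h⟩ := (hmem k y).1 hy
      exact (hmem _ y).2 ⟨x, hx, j, by omega, h⟩
    by_cases hlt : (U k).card < (U (k + 1)).card
    · omega
    have heq : U k = U (k + 1) := eq_of_subset_of_card_le hsub (not_lt.1 hlt)
    have huniv : U k = univ := by
      refine ZMod.eq_univ_of_forall_add_one_mem (hS.mono (hSU k)) fun y hy => ?_
      obtain ⟨x, hx, j, hj, h⟩ := (hmem k y).1 hy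
      rw [heq]
      exact (hmem _ _).2 ⟨x, hx, j + 1, by omega, by push_cast; rw [h]; ring⟩
    rw [← heq, huniv, card_univ, ZMod.card]
    exact min_le_left _ _

/-- Injections along edges of the circulant graph, defined on `k` residues, extend to
permutations. -/
theorem exists_perm_extending {n k : ℕ} [NeZero n] {T : Finset (ZMod n)} (hT : T.card = k)
    {g : ZMod n → ZMod n} (hg : Set.InjOn g T)
    (hgD : ∀ x ∈ T, g x - x ∈ initialResidues n k) :
    ∃ π : Equiv.Perm (ZMod n), (∀ x, π x - x ∈ initialResidues n k) ∧ ∀ x ∈ T, π x = g x := by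
  classical
  obtain ⟨h, hinj, hh⟩ := (Finset.all_card_le_biUnion_card_iff_exists_injective
    fun x : {x // x ∉ T} =>
      (univ.filter fun y => y - x.1 ∈ initialResidues n k) \ T.image g).1 (fun s => by
      rcases s.eq_empty_or_nonempty with rfl | hs
      · simp
      set S : Finset (ZMod n) := s.map (Function.Embedding.subtype _) with hSdef
      have hScard : S.card = s.card := card_map _
      have hdisj : Disjoint S T := disjoint_left.2 fun x hx => by
        obtain ⟨y, -, rfl⟩ := mem_map.1 hx
        exact y.2
      have hle : S.card + k ≤ n := by
        rw [← hT, ← card_union_of_disjoint hdisj]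
        simpa using card_le_univ (S ∪ T)
      have hmin := min_le_card_of_forall_add_mem (S := S) (by simpa [hSdef] using hs) k
      rw [min_eq_right hle] at hmin
      have hTg : (T.image g).card ≤ k := hT ▸ card_image_le
      have hsd := le_card_sdiff (T.image g)
        (univ.filter fun y => ∃ x ∈ S, y - x ∈ initialResidues n k)
      refine le_trans (by omega) (hsd.trans (card_le_card ?_))
      intro y hy
      obtain ⟨hy1, hy2⟩ := mem_sdiff.1 hy
      obtain ⟨x, hx, hyx⟩ := (mem_filter.1 hy1).2
      obtain ⟨z, hz, rfl⟩ := mem_map.1 hx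
      exact mem_biUnion.2 ⟨z, hz, mem_sdiff.2 ⟨by simpa using hyx, hy2⟩⟩)
  have hh' : ∀ x, h x - x.1 ∈ initialResidues n k ∧ ∀ y ∈ T, g y ≠ h x := fun x => by
    simpa using hh x
  set r : ZMod n → ZMod n := fun x => if hx : x ∈ T then g x else h ⟨x, hx⟩
  have hrT : ∀ x ∈ T, r x = g x := fun x hx => dif_pos hx
  have hrN : ∀ x (hx : x ∉ T), r x = h ⟨x, hx⟩ := fun x hx => dif_neg hx
  have hrinj : Function.Injective r := fun x y hxy => by
    by_cases hx : x ∈ T <;> by_cases hy : y ∈ T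
    · rw [hrT x hx, hrT y hy] at hxy
      exact hg hx hy hxy
    · rw [hrT x hx, hrN y hy] at hxy
      exact absurd hxy ((hh' _).2 x hx)
    · rw [hrN x hx, hrT y hy] at hxy
      exact absurd hxy.symm ((hh' _).2 y hy)
    · rw [hrN x hx, hrN y hy] at hxy
      simpa using hinj hxy
  refine ⟨Equiv.ofBijective r (Finite.injective_iff_bijective.1 hrinj), fun x => ?_, hrT⟩
  change r x - x ∈ _
  by_cases hx : x ∈ T
  · rw [hrT x hx]
    exact hgD x hx
  · rw [hrN x hx]
    exact (hh' _).1

/-- The colouring of the bipartite circulant graph by sides. -/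
def circulantBipartite.coloring (n k : ℕ) : (circulantBipartite n k).Coloring Bool :=
  Coloring.mk Sum.isLeft (by rintro (x | x) (y | y) h <;> simp_all)

theorem circulantBipartite_connected {n k : ℕ} [NeZero n] (hk : 1 ≤ k) :
    (circulantBipartite n k).Connected := by
  have h0 : ∀ x, (circulantBipartite n k).Adj (.inl x) (.inr x) := fun x =>
    mem_image.2 ⟨0, by simp, by simp⟩
  have h1 : ∀ x, (circulantBipartite n k).Adj (.inl x) (.inr (x + 1)) := fun x =>
    mem_image.2 ⟨1, by simp; omega, by simp⟩
  have hl : ∀ m : ℕ, (circulantBipartite n k).Reachable (.inl 0) (.inl (m : ZMod n)) := by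
    intro m
    induction m with
    | zero => simp
    | succ m ih =>
      push_cast
      exact ih.trans ((h1 _).reachable.trans (h0 _).symm.reachable)
  have hl' : ∀ x, (circulantBipartite n k).Reachable (.inl 0) (.inl x) := fun x => by
    simpa using hl x.val
  refine (connected_iff_exists_forall_reachable _).2 ⟨.inl 0, ?_⟩
  rintro (x | x)
  exacts [hl' x, (hl' x).trans (h0 x).reachable]

theorem circulantBipartite_isExtendable {n k : ℕ} [NeZero n] (hk : 1 ≤ k) (hn : k + 1 ≤ n) :
    IsExtendable (circulantBipartite n k) k := by
  classical
  refine isExtendable_of_exists_isPairing (circulantBipartite_connected hk)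
    (circulantBipartite.coloring n k) true ?_ fun T f hT hf hTk => ?_
  · obtain ⟨T, -, hT⟩ := exists_subset_card_eq (s := (univ : Finset (ZMod n))) (n := k)
      (by simp; omega)
    refine ⟨T.map Function.Embedding.inl, Sum.swap, fun x hx => ?_,
      (Equiv.sumComm _ _).injective.injOn, by simpa using hT⟩
    obtain ⟨y, -, rfl⟩ := mem_map.1 hx
    exact ⟨rfl, mem_image.2 ⟨0, by simp, by simp⟩⟩
  · have hinl : ∀ x ∈ T, ∃ a b, x = .inl a ∧ f x = .inr b ∧ b - a ∈ initialResidues n k := by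
      intro x hx
      obtain ⟨h1, h2⟩ := hT x hx
      rcases x with a | a
      · rcases hb : f (.inl a) with b | b <;> rw [hb] at h2
        · exact h2.elim
        · exact ⟨a, b, rfl, rfl, h2⟩
      · exact (Bool.false_ne_true h1).elim
    have hcard : (univ.filter fun a : ZMod n => Sum.inl a ∈ T).card = k := by
      rw [← hTk, ← card_map Function.Embedding.inl]
      congr 1
      ext x
      simp only [mem_map, mem_filter, mem_univ, true_and, Function.Embedding.inl_apply]
      constructor
      · rintro ⟨a, ha, rfl⟩
        exact ha
      · intro hx
        obtain ⟨a, -, rfl, -⟩ := hinl x hx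
        exact ⟨a, hx, rfl⟩
    set g : ZMod n → ZMod n := fun a => (f (.inl a)).elim id id with hgdef
    have hg : ∀ a, Sum.inl a ∈ T → f (.inl a) = .inr (g a) ∧ g a - a ∈ initialResidues n k := by
      intro a ha
      obtain ⟨a', b, h1, h2, h3⟩ := hinl _ ha
      obtain rfl := Sum.inl_injective h1
      simpa [hgdef, h2] using h3
    obtain ⟨π, hπ, hπT⟩ := exists_perm_extending hcard (g := g)
      (fun a ha b hb hab => by
        have ha' : Sum.inl a ∈ T := by simpa using ha
        have hb' : Sum.inl b ∈ T := by simpa using hb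
        exact Sum.inl_injective (hf ha' hb' (by rw [(hg a ha').1, (hg b hb').1, hab])))
      (fun a ha => (hg a (by simpa using ha)).2)
    refine ⟨Sum.elim (fun a => .inr (π a)) fun b => .inl (π.symm b), ⟨?_, ?_⟩, fun x hx => ?_⟩
    · rintro (a | b)
      · exact hπ a
      · have := hπ (π.symm b)
        rwa [π.apply_symm_apply] at this
    · rintro (a | b) <;> simp
    · obtain ⟨a, -, rfl, -⟩ := hinl x hx
      rw [(hg a hx).1, ← hπT a (by simpa using hx), Sum.elim_inl]

theorem circulantBipartite_isRegularOfDegree {n k : ℕ} [NeZero n] (hn : k + 1 ≤ n)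
    [DecidableRel (circulantBipartite n k).Adj] :
    (circulantBipartite n k).IsRegularOfDegree (k + 1) := by
  classical
  intro v
  rw [← card_neighborFinset_eq_degree, ← card_initialResidues hn]
  rcases v with x | y
  · refine card_nbij' (fun w => w.elim id id - x) (fun d => .inr (d + x)) ?_ ?_ ?_ ?_
    · rintro (w | w) hw <;> simp_all
    · intro d hd
      simp_all
    · rintro (w | w) hw <;> simp_all
    · intro d hd
      simp
  · refine card_nbij' (fun w => y - w.elim id id) (fun d => .inl (y - d)) ?_ ?_ ?_ ?_
    · rintro (w | w) hw <;> simp_all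
    · intro d hd
      simp_all
    · rintro (w | w) hw <;> simp_all
    · intro d hd
      simp

theorem ncard_edgeSet_circulantBipartite {n k : ℕ} [NeZero n] (hn : k + 1 ≤ n) :
    (circulantBipartite n k).edgeSet.ncard = n * (k + 1) := by
  classical
  have hsum := sum_degrees_eq_twice_card_edges (circulantBipartite n k)
  simp only [(circulantBipartite_isRegularOfDegree hn).degree_eq, sum_const, card_univ,
    Fintype.card_sum, ZMod.card, smul_eq_mul] at hsum
  rw [← coe_edgeFinset, Set.ncard_coe_finset]
  linarith

end Circulant

theorem minSize_extendable_bipartite (k ν : ℕ) (hk : 1 ≤ k) (hν : 2 * k + 2 ≤ ν)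
    (heven : Even ν) :
    (∀ (V : Type) [Fintype V] (G : SimpleGraph V), Fintype.card V = ν →
      G.Colorable 2 → IsExtendable G k → ν * (k + 1) / 2 ≤ G.edgeSet.ncard) ∧
    (∃ G : SimpleGraph (Fin ν), G.Colorable 2 ∧ IsExtendable G k ∧
      G.edgeSet.ncard = ν * (k + 1) / 2) := by
  classical
  constructor
  · intro V _ G hV hc hG
    obtain ⟨c⟩ := hc
    have c' : G.Coloring Bool := (recolorOfEquiv G finTwoEquiv) c
    have hdeg := Finset.card_nsmul_le_sum Finset.univ (fun v => G.degree v) (k + 1)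
      fun v _ => hG.lt_degree hk (hV ▸ hν) c' v
    rw [sum_degrees_eq_twice_card_edges, Finset.card_univ, hV, smul_eq_mul] at hdeg
    rw [← coe_edgeFinset, Set.ncard_coe_finset]
    omega
  · obtain ⟨n, rfl⟩ := heven
    have hn : k + 1 ≤ n := by omega
    have : NeZero n := ⟨by omega⟩
    let e : ZMod n ⊕ ZMod n ≃ Fin (n + n) :=
      Fintype.equivFinOfCardEq (by rw [Fintype.card_sum, ZMod.card])
    let φ := Iso.map e (circulantBipartite n k)
    refine ⟨_, ?_, (circulantBipartite_isExtendable hk hn).of_iso φ, ?_⟩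
    · exact Colorable.of_hom φ.symm.toHom
        ⟨recolorOfEquiv _ finTwoEquiv.symm (circulantBipartite.coloring n k)⟩
    · have hcard := φ.card_edgeFinset_eq
      have hedge := ncard_edgeSet_circulantBipartite (n := n) hn
      rw [← coe_edgeFinset, Set.ncard_coe_finset] at hedge ⊢
      rw [← hcard, hedge, ← two_mul, mul_assoc, Nat.mul_div_cancel_left _ two_pos]
end

section
/- For every even integer ν ≥ 4: every 1-extendable non-bipartite finite simple graph on ν vertices has at least ν+2 edges, and there exists a 1-extendable non-bipartite finite simple graph on ν vertices with exactly ν+2 edges. Hence ε(ν,1) = ν+2, where ε(ν,k) denotes the minimum size of a k-extendable non-bipartite graph on ν vertices. -/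
open SimpleGraph

namespace SimpleGraph

variable {V : Type*} {G : SimpleGraph V}

theorem isExtendable_one_iff :
    IsExtendable G 1 ↔ G.Connected ∧ (∃ u v, G.Adj u v) ∧
      ∀ u v, G.Adj u v → ∃ P : G.Subgraph, P.IsPerfectMatching ∧ P.Adj u v := by
  have single {u v : V} (h : G.Adj u v) : (G.subgraphOfAdj h).IsMatching ∧
      (G.subgraphOfAdj h).edgeSet.ncard = 1 :=
    ⟨Subgraph.IsMatching.subgraphOfAdj h, by simp⟩
  refine ⟨fun ⟨hc, ⟨M, _, hM⟩, hext⟩ ↦ ⟨hc, ?_, fun u v h ↦ ?_⟩,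
    fun ⟨hc, ⟨u, v, h⟩, hext⟩ ↦ ⟨hc, ⟨_, single h⟩, fun M hM hcard ↦ ?_⟩⟩
  · obtain ⟨e, he⟩ := Set.ncard_eq_one.mp hM
    induction e with | _ u v
    have : M.Adj u v := by rw [← Subgraph.mem_edgeSet, he]; rfl
    exact ⟨u, v, this.adj_sub⟩
  · obtain ⟨P, hP, hle⟩ := hext _ (single h).1 (single h).2
    exact ⟨P, hP, hle.2 (by simp)⟩
  · obtain ⟨e, he⟩ := Set.ncard_eq_one.mp hcard
    induction e with | _ a b
    have hab : M.Adj a b := by rw [← Subgraph.mem_edgeSet, he]; rfl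
    obtain ⟨P, hP, hPab⟩ := hext a b hab.adj_sub
    refine ⟨P, hP, fun x _ ↦ hP.2 x, fun x y hxy ↦ ?_⟩
    have hmem : s(x, y) ∈ M.edgeSet := hxy
    rw [he, Set.mem_singleton_iff, ← Subgraph.mem_edgeSet] at *
    rwa [← hmem] at hPab

/-- The perfect matching whose edges are the orbits of an involution along edges of `G`. -/
theorem exists_isPerfectMatching_of_involutive {f : V → V} (hf : Function.Involutive f)
    (hadj : ∀ v, G.Adj v (f v)) :
    ∃ P : G.Subgraph, P.IsPerfectMatching ∧ ∀ v, P.Adj v (f v) := by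
  refine ⟨⟨Set.univ, fun v w ↦ f v = w, ?_, fun _ ↦ trivial, ⟨?_⟩⟩, ?_, fun _ ↦ rfl⟩
  · rintro v w rfl
    exact hadj v
  · rintro v w rfl
    exact hf v
  · rw [Subgraph.isPerfectMatching_iff]
    exact fun v ↦ ⟨f v, rfl, fun w hw ↦ Eq.symm hw⟩

/-- A potential that is negated along the edges of a connected non-bipartite graph vanishes. -/
theorem Connected.eq_zero_of_add_eq_zero (hc : G.Connected) (hG : ¬ G.Colorable 2)
    {y : V → ℚ} (hy : ∀ u v, G.Adj u v → y u + y v = 0) : y = 0 := by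
  by_contra hne
  obtain ⟨a, ha⟩ := Function.ne_iff.mp hne
  have habs (v : V) : |y v| = |y a| := by
    obtain ⟨p⟩ := hc.preconnected v a
    induction p with
    | nil => rfl
    | cons h _ ih => rw [← ih ha, eq_neg_of_add_eq_zero_left (hy _ _ h), abs_neg]
  refine hG ((Coloring.mk (fun v ↦ decide (0 < y v)) fun {u v} h heq ↦ ?_ :
    G.Coloring Bool).colorable)
  have hu : y u ≠ 0 := fun h0 ↦ ha (by simpa [h0] using (habs u).symm)
  have hs := hy u v h
  simp only [decide_eq_decide] at heq
  rcases hu.lt_or_gt with hlg | hlg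
  · linarith [heq.mpr (by linarith)]
  · linarith [heq.mp hlg]

open Classical in
/-- The vertex-edge incidence matrix with columns restricted to the edges of `G`. -/
noncomputable def edgeIncMatrix (G : SimpleGraph V) : Matrix V G.edgeSet ℚ :=
  Matrix.of fun v e ↦ if v ∈ (e : Sym2 V) then 1 else 0

open Classical in
/-- The characteristic vector of the edges of a subgraph. -/
noncomputable def Subgraph.edgeVec (P : G.Subgraph) : G.edgeSet → ℚ :=
  fun e ↦ if (e : Sym2 V) ∈ P.edgeSet then 1 else 0

theorem Subgraph.edgeVec_eq_zero_or_one (P : G.Subgraph) (e : G.edgeSet) :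
    P.edgeVec e = 0 ∨ P.edgeVec e = 1 := by
  unfold edgeVec
  split_ifs <;> simp

theorem sum_edgeIncMatrix [Fintype V] (e : G.edgeSet) : ∑ v, G.edgeIncMatrix v e = 2 := by
  classical
  obtain ⟨e, he⟩ := e
  induction e with | _ u v
  have huv : u ≠ v := G.ne_of_adj he
  have : (Finset.univ.filter fun w ↦ w = u ∨ w = v) = {u, v} := by ext; simp
  simp [edgeIncMatrix, this, Finset.card_pair huv]

variable [Fintype G.edgeSet]

theorem Subgraph.IsPerfectMatching.edgeIncMatrix_mulVec {P : G.Subgraph}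
    (hP : P.IsPerfectMatching) : G.edgeIncMatrix.mulVec P.edgeVec = 1 := by
  classical
  ext v
  obtain ⟨w, hw, huniq⟩ := Subgraph.isPerfectMatching_iff.mp hP v
  have hmem : s(v, w) ∈ G.edgeSet := hw.adj_sub
  simp only [Matrix.mulVec, dotProduct, Pi.one_apply]
  rw [Finset.sum_eq_single ⟨s(v, w), hmem⟩]
  · simp [edgeIncMatrix, edgeVec, hw]
  · rintro ⟨e, he⟩ - hne
    by_cases hv : v ∈ e
    · obtain ⟨u, rfl⟩ := hv
      have : ¬ P.Adj v u := fun h ↦ hne (by simp [huniq u h])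
      simp [edgeVec, this]
    · simp [edgeIncMatrix, hv]
  · simp

variable [Fintype V]

theorem sum_edgeIncMatrix_mulVec (x : G.edgeSet → ℚ) :
    ∑ v, (G.edgeIncMatrix.mulVec x) v = 2 * ∑ e, x e := by
  simp only [Matrix.mulVec, dotProduct]
  rw [Finset.sum_comm, Finset.mul_sum]
  exact Finset.sum_congr rfl fun e _ ↦ by rw [← Finset.sum_mul, sum_edgeIncMatrix]

theorem Subgraph.IsPerfectMatching.two_mul_sum_edgeVec {P : G.Subgraph}
    (hP : P.IsPerfectMatching) : 2 * ∑ e, P.edgeVec e = Fintype.card V := by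
  rw [← sum_edgeIncMatrix_mulVec, hP.edgeIncMatrix_mulVec]
  simp

theorem Connected.finrank_ker_edgeIncMatrix (hc : G.Connected) (hG : ¬ G.Colorable 2) :
    Module.finrank ℚ (LinearMap.ker G.edgeIncMatrix.mulVecLin) + Fintype.card V =
      Fintype.card G.edgeSet := by
  classical
  have hinj : Function.Injective G.edgeIncMatrix.transpose.mulVecLin := by
    rw [← LinearMap.ker_eq_bot, LinearMap.ker_eq_bot']
    intro y hy
    refine hc.eq_zero_of_add_eq_zero hG fun u v h ↦ ?_
    have huv := congrFun hy ⟨s(u, v), h⟩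
    have hset : (Finset.univ.filter fun w ↦ w = u ∨ w = v) = {u, v} := by ext; simp
    simpa [Matrix.vecMul, dotProduct, edgeIncMatrix, ← Finset.sum_filter, hset,
      Finset.sum_pair h.ne] using huv
  have hrank : G.edgeIncMatrix.rank = Fintype.card V := by
    rw [← Matrix.rank_transpose, Matrix.rank, LinearMap.finrank_range_of_inj hinj,
      Module.finrank_fintype_fun_eq_card]
  have := G.edgeIncMatrix.mulVecLin.finrank_range_add_finrank_ker
  rw [Module.finrank_fintype_fun_eq_card] at this
  rw [Matrix.rank] at hrank
  omega

/-- If the incidence matrix has nullity at most one, then the characteristic vectors of perfect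
matchings lie on a line, which meets the vertices of the cube in at most two points. -/
theorem exists_edgeVec_eq_or_eq
    (hker : Module.finrank ℚ (LinearMap.ker G.edgeIncMatrix.mulVecLin) ≤ 1)
    {P : G.Subgraph} (hP : P.IsPerfectMatching) :
    ∃ Q : G.Subgraph, Q.IsPerfectMatching ∧ ∀ R : G.Subgraph, R.IsPerfectMatching →
      R.edgeVec = P.edgeVec ∨ R.edgeVec = Q.edgeVec := by
  have hmem {R : G.Subgraph} (hR : R.IsPerfectMatching) :
      R.edgeVec - P.edgeVec ∈ LinearMap.ker G.edgeIncMatrix.mulVecLin := by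
    simp [Matrix.mulVec_sub, hR.edgeIncMatrix_mulVec, hP.edgeIncMatrix_mulVec]
  by_cases hall : ∀ R : G.Subgraph, R.IsPerfectMatching → R.edgeVec = P.edgeVec
  · exact ⟨P, hP, fun R hR ↦ Or.inl (hall R hR)⟩
  push Not at hall
  obtain ⟨Q, hQ, hne⟩ := hall
  refine ⟨Q, hQ, fun R hR ↦ ?_⟩
  obtain ⟨e, he⟩ := Function.ne_iff.mp hne
  obtain ⟨z, hz⟩ := finrank_le_one_iff.mp hker
  obtain ⟨b, hb⟩ := hz ⟨_, hmem hQ⟩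
  obtain ⟨c, hc⟩ := hz ⟨_, hmem hR⟩
  have hb (e) : b * z.1 e = Q.edgeVec e - P.edgeVec e :=
    congrFun (congrArg Subtype.val hb) e
  have hc (e) : c * z.1 e = R.edgeVec e - P.edgeVec e :=
    congrFun (congrArg Subtype.val hc) e
  have hze : z.1 e ≠ 0 := fun h0 ↦ he (by linarith [hb e, h0 ▸ mul_zero b, congrArg (b * ·) h0])
  have hcases : R.edgeVec e = P.edgeVec e ∨ R.edgeVec e = Q.edgeVec e := by
    rcases P.edgeVec_eq_zero_or_one e with h1 | h1 <;>
    rcases Q.edgeVec_eq_zero_or_one e with h2 | h2 <;>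
    rcases R.edgeVec_eq_zero_or_one e with h3 | h3 <;> simp_all
  rcases hcases with h | h
  · have hc0 : c = 0 := by
      have := hc e
      rw [h, sub_self] at this
      exact (mul_eq_zero.mp this).resolve_right hze
    left
    ext i
    have := hc i
    rw [hc0, zero_mul] at this
    linarith
  · have hcb : c = b := mul_right_cancel₀ hze (by rw [hb, hc, h])
    right
    ext i
    linarith [hb i, hcb ▸ hc i]

/-- A 1-extendable non-bipartite graph has at least two more edges than vertices. -/
theorem card_add_two_le_card_edgeSet (hext : IsExtendable G 1) (hG : ¬ G.Colorable 2) :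
    Fintype.card V + 2 ≤ Fintype.card G.edgeSet := by
  obtain ⟨hc, ⟨u, v, huv⟩, hext⟩ := isExtendable_one_iff.mp hext
  have hV : 0 < Fintype.card V := Fintype.card_pos_iff.mpr ⟨u⟩
  have hrank := hc.finrank_ker_edgeIncMatrix hG
  by_contra! hlt
  obtain ⟨P, hP, -⟩ := hext u v huv
  obtain ⟨Q, hQ, hPQ⟩ := exists_edgeVec_eq_or_eq (by omega) hP
  have hone (e : G.edgeSet) : P.edgeVec e = 1 ∨ Q.edgeVec e = 1 := by
    obtain ⟨e, he⟩ := e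
    induction e with | _ a b
    obtain ⟨R, hR, hab⟩ := hext a b he
    have hRe : R.edgeVec ⟨s(a, b), he⟩ = 1 := by simp [Subgraph.edgeVec, hab]
    rcases hPQ R hR with h | h
    · exact Or.inl (h ▸ hRe)
    · exact Or.inr (h ▸ hRe)
  have hcover : (Fintype.card G.edgeSet : ℚ) ≤ ∑ e, (P.edgeVec e + Q.edgeVec e) := by
    have : (Fintype.card G.edgeSet : ℚ) = ∑ _e : G.edgeSet, 1 := by simp
    rw [this]
    refine Finset.sum_le_sum fun e _ ↦ ?_
    rcases hone e with h | h
    · rcases Q.edgeVec_eq_zero_or_one e with hpq | hpq <;> rw [h, hpq] <;> norm_num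
    · rcases P.edgeVec_eq_zero_or_one e with hpq | hpq <;> rw [h, hpq] <;> norm_num
  have hPsum := hP.two_mul_sum_edgeVec
  have hQsum := hQ.two_mul_sum_edgeVec
  have hle : Fintype.card G.edgeSet ≤ Fintype.card V := by
    rw [Finset.sum_add_distrib] at hcover
    have : (Fintype.card G.edgeSet : ℚ) ≤ Fintype.card V := by linarith
    exact_mod_cast this
  have hbot : LinearMap.ker G.edgeIncMatrix.mulVecLin = ⊥ :=
    Submodule.finrank_eq_zero.mp (by omega)
  have heq : P.edgeVec = Q.edgeVec := by
    apply LinearMap.ker_eq_bot.mp hbot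
    simp [hP.edgeIncMatrix_mulVec, hQ.edgeIncMatrix_mulVec]
  have hsum : ∑ e, P.edgeVec e = Fintype.card G.edgeSet := by
    rw [Finset.sum_congr rfl fun e _ ↦ (show P.edgeVec e = 1 from by
      rcases hone e with h | h
      · exact h
      · rw [heq, h])]
    simp
  rw [hsum] at hPsum
  have : 2 * Fintype.card G.edgeSet = Fintype.card V := by exact_mod_cast hPsum
  omega

end SimpleGraph

/-- The cycle on `Fin n` together with the chords `02` and `13`: a subdivision of `K₄` in which
at most one edge is subdivided. -/
def subdividedK4 (n : ℕ) : SimpleGraph (Fin n) :=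
  SimpleGraph.fromRel fun a b ↦ b.val = a.val + 1 ∨ (a.val + 1 = n ∧ b.val = 0) ∨
    (a.val = 0 ∧ b.val = 2) ∨ (a.val = 1 ∧ b.val = 3)

namespace subdividedK4

variable {n : ℕ}

theorem adj_iff {a b : Fin n} : (subdividedK4 n).Adj a b ↔ a.val ≠ b.val ∧
    ((b.val = a.val + 1 ∨ (a.val + 1 = n ∧ b.val = 0) ∨
      (a.val = 0 ∧ b.val = 2) ∨ (a.val = 1 ∧ b.val = 3)) ∨
    (a.val = b.val + 1 ∨ (b.val + 1 = n ∧ a.val = 0) ∨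
      (b.val = 0 ∧ a.val = 2) ∨ (b.val = 1 ∧ a.val = 3))) := by
  simp only [subdividedK4, SimpleGraph.fromRel_adj, ne_eq, Fin.ext_iff]

theorem connected (hn : 4 ≤ n) : (subdividedK4 n).Connected := by
  have hreach : ∀ k (hk : k < n), (subdividedK4 n).Reachable ⟨0, by omega⟩ ⟨k, hk⟩ := by
    intro k
    induction k with
    | zero => exact fun _ ↦ .refl _
    | succ k ih =>
      exact fun hk ↦ (ih (by omega)).trans
        (SimpleGraph.Adj.reachable (adj_iff.mpr (by simp)))
  have : Nonempty (Fin n) := ⟨⟨0, by omega⟩⟩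
  exact ⟨fun a b ↦ (hreach a a.2).symm.trans (hreach b b.2)⟩

theorem not_colorable_two (hn : 4 ≤ n) : ¬ (subdividedK4 n).Colorable 2 := by
  rintro ⟨C⟩
  have h01 := C.valid (v := ⟨0, by omega⟩) (w := ⟨1, by omega⟩) (adj_iff.mpr (by simp))
  have h12 := C.valid (v := ⟨1, by omega⟩) (w := ⟨2, by omega⟩) (adj_iff.mpr (by simp))
  have h02 := C.valid (v := ⟨0, by omega⟩) (w := ⟨2, by omega⟩) (adj_iff.mpr (by simp))
  omega

theorem ncard_edgeSet_le (hn : 4 ≤ n) : (subdividedK4 n).edgeSet.ncard ≤ n + 2 := by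
  classical
  let next (i : Fin n) : Fin n := ⟨if i.val + 1 = n then 0 else i.val + 1, by split_ifs <;> omega⟩
  let edges : Finset (Sym2 (Fin n)) := Finset.univ.image (fun i ↦ s(i, next i)) ∪
    {s(⟨0, by omega⟩, ⟨2, by omega⟩), s(⟨1, by omega⟩, ⟨3, by omega⟩)}
  have hsub : (subdividedK4 n).edgeSet ⊆ edges := by
    have key {a b : Fin n} (h : b.val = a.val + 1 ∨ (a.val + 1 = n ∧ b.val = 0) ∨
        (a.val = 0 ∧ b.val = 2) ∨ (a.val = 1 ∧ b.val = 3)) : s(a, b) ∈ edges := by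
      simp only [edges, Finset.mem_union, Finset.mem_image, Finset.mem_univ, true_and,
        Finset.mem_insert, Finset.mem_singleton]
      rcases h with h | h | h | h
      · refine Or.inl ⟨a, ?_⟩
        have : next a = b := Fin.ext (by simp only [next]; split_ifs <;> omega)
        rw [this]
      · refine Or.inl ⟨a, ?_⟩
        have : next a = b := Fin.ext (by simp only [next]; split_ifs <;> omega)
        rw [this]
      · exact Or.inr (Or.inl (by simp [Fin.ext_iff, h]))
      · exact Or.inr (Or.inr (by simp [Fin.ext_iff, h]))
    intro e he
    induction e with | _ a b
    rcases (adj_iff.mp he).2 with h | h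
    · exact key h
    · rw [Sym2.eq_swap]
      exact key h
  calc (subdividedK4 n).edgeSet.ncard ≤ (edges : Set (Sym2 (Fin n))).ncard :=
        Set.ncard_le_ncard hsub (Finset.finite_toSet _)
    _ = edges.card := Set.ncard_coe_finset _
    _ ≤ _ := (Finset.card_union_le _ _).trans (Nat.add_le_add
        (Finset.card_image_le.trans (by simp)) Finset.card_le_two)

theorem exists_isPerfectMatching_of_nat (f : ℕ → ℕ) (hlt : ∀ k < n, f k < n)
    (hinv : ∀ k < n, f (f k) = k)
    (hadj : ∀ a b : Fin n, f a = b → (subdividedK4 n).Adj a b) :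
    ∃ P : (subdividedK4 n).Subgraph, P.IsPerfectMatching ∧
      ∀ a b : Fin n, f a = b → P.Adj a b := by
  obtain ⟨P, hP, h⟩ := SimpleGraph.exists_isPerfectMatching_of_involutive
    (G := subdividedK4 n) (f := fun a : Fin n ↦ ⟨f a, hlt a a.2⟩)
    (fun a ↦ Fin.ext (hinv a a.2)) (fun a ↦ hadj _ _ rfl)
  refine ⟨P, hP, fun a b hab ↦ ?_⟩
  obtain rfl : (⟨f a, hlt a a.2⟩ : Fin n) = b := Fin.ext hab
  exact h a

theorem isExtendable_one (heven : Even n) (hn : 4 ≤ n) : IsExtendable (subdividedK4 n) 1 := by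
  obtain ⟨m, hm⟩ := heven
  obtain ⟨P, hP, hPadj⟩ := exists_isPerfectMatching_of_nat (n := n)
    (fun k ↦ if k % 2 = 0 then k + 1 else k - 1) (by grind) (by grind)
    (fun a b h ↦ adj_iff.mpr (by grind))
  obtain ⟨Q, hQ, hQadj⟩ := exists_isPerfectMatching_of_nat (n := n)
    (fun k ↦ if k % 2 = 1 then (if k + 1 = n then 0 else k + 1) else
      (if k = 0 then n - 1 else k - 1)) (by grind) (by grind)
    (fun a b h ↦ adj_iff.mpr (by grind))
  obtain ⟨R, hR, hRadj⟩ := exists_isPerfectMatching_of_nat (n := n)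
    (fun k ↦ if k < 4 then (k + 2) % 4 else if k % 2 = 0 then k + 1 else k - 1)
    (by grind) (by grind) (fun a b h ↦ adj_iff.mpr (by grind))
  have hmatch {a b : Fin n} (h : b.val = a.val + 1 ∨ (a.val + 1 = n ∧ b.val = 0) ∨
      (a.val = 0 ∧ b.val = 2) ∨ (a.val = 1 ∧ b.val = 3)) :
      ∃ M : (subdividedK4 n).Subgraph, M.IsPerfectMatching ∧ M.Adj a b := by
    by_cases hchord : a.val + 2 = b.val
    · exact ⟨R, hR, hRadj a b (by grind)⟩
    by_cases hpar : a.val % 2 = 0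
    · exact ⟨P, hP, hPadj a b (by grind)⟩
    · exact ⟨Q, hQ, hQadj a b (by grind)⟩
  refine SimpleGraph.isExtendable_one_iff.mpr ⟨connected hn,
    ⟨⟨0, by omega⟩, ⟨1, by omega⟩, adj_iff.mpr (by simp)⟩, fun a b hab ↦ ?_⟩
  rcases (adj_iff.mp hab).2 with h | h
  · exact hmatch h
  · obtain ⟨M, hM, hba⟩ := hmatch h
    exact ⟨M, hM, hba.symm⟩

end subdividedK4

theorem minSize_oneExtendable_nonbipartite (ν : ℕ) (heven : Even ν) (hν : 4 ≤ ν) :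
    (∀ (V : Type) [Fintype V] (G : SimpleGraph V), Fintype.card V = ν →
      IsExtendable G 1 → ¬ G.Colorable 2 → ν + 2 ≤ G.edgeSet.ncard) ∧
    (∃ G : SimpleGraph (Fin ν), IsExtendable G 1 ∧ ¬ G.Colorable 2 ∧
      G.edgeSet.ncard = ν + 2) := by
  classical
  have lower (V : Type) [Fintype V] (G : SimpleGraph V) (hV : Fintype.card V = ν)
      (hext : IsExtendable G 1) (hG : ¬ G.Colorable 2) : ν + 2 ≤ G.edgeSet.ncard := by
    rw [← Nat.card_coe_set_eq, Nat.card_eq_fintype_card, ← hV]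
    exact SimpleGraph.card_add_two_le_card_edgeSet hext hG
  have hext := subdividedK4.isExtendable_one heven hν
  have hcol := subdividedK4.not_colorable_two hν
  exact ⟨lower, subdividedK4 ν, hext, hcol,
    (subdividedK4.ncard_edgeSet_le hν).antisymm (lower _ _ (Fintype.card_fin ν) hext hcol)⟩
end
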